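/- arXiv:1903.01606 — 7 statements merged into one kernel-verified Lean document; each statement's English description precedes it below -/
import Mathlib

section
/- Let ℓ ≥ r ≥ 2 and let H be an n-vertex K_{ℓ+1}^{(r)}-free r-graph on [n]. Then the number of edges of H is at most binom(ℓ,r)·(n/ℓ)^r. -/
open Finset
open scoped Classical

/-- `H` is `K_{ℓ+1}^{(r)}`-free: no `(ℓ+1)`-set `S` such that every pair of distinct
vertices of `S` is covered by an edge of `H`. -/
def KKFree (n ℓ : ℕ) (H : Finset (Finset (Fin n))) : Prop :=
  ¬ ∃ S : Finset (Fin n), S.card = ℓ + 1 ∧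
      ∀ x ∈ S, ∀ y ∈ S, x ≠ y → ∃ e ∈ H, x ∈ e ∧ y ∈ e

/-- The `r`-element cliques of `G` inside the vertex set `S`. -/
noncomputable def cliquesIn {V : Type*} (G : SimpleGraph V) (S : Finset V) (r : ℕ) :
    Finset (Finset V) :=
  {T ∈ S.powersetCard r | G.IsClique (T : Set V)}

/-- The neighbours of `v` in `G` inside the vertex set `S`. -/
noncomputable def neighborsIn {V : Type*} (G : SimpleGraph V) (S : Finset V) (v : V) :
    Finset V :=
  {u ∈ S | G.Adj v u}

lemma mem_cliquesIn {V : Type*} {G : SimpleGraph V} {S T : Finset V} {r : ℕ} :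
    T ∈ cliquesIn G S r ↔ (T ⊆ S ∧ T.card = r) ∧ G.IsClique (T : Set V) := by
  simp [cliquesIn, mem_powersetCard]

/-- A clique either lies in `N` or consists of a vertex `u` outside `N` and a clique in the
neighbourhood of `u`. -/
lemma card_cliquesIn_succ_le {V : Type*} (G : SimpleGraph V) (S N : Finset V) (k : ℕ) :
    (cliquesIn G S (k + 1)).card ≤ (cliquesIn G N (k + 1)).card +
      ∑ u ∈ S \ N, (cliquesIn G (neighborsIn G S u) k).card := by
  have hsub : cliquesIn G S (k + 1) ⊆ cliquesIn G N (k + 1) ∪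
      (S \ N).biUnion fun u => (cliquesIn G (neighborsIn G S u) k).image (insert u) := by
    intro T hT
    obtain ⟨⟨hTS, hTc⟩, hTq⟩ := mem_cliquesIn.1 hT
    by_cases hTN : T ⊆ N
    · exact mem_union_left _ (mem_cliquesIn.2 ⟨⟨hTN, hTc⟩, hTq⟩)
    · obtain ⟨u, huT, huN⟩ := not_subset.1 hTN
      refine mem_union_right _ (mem_biUnion.2 ⟨u, mem_sdiff.2 ⟨hTS huT, huN⟩, ?_⟩)
      refine mem_image.2 ⟨T.erase u, mem_cliquesIn.2 ⟨⟨fun w hw => ?_, ?_⟩, ?_⟩,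
        insert_erase huT⟩
      · obtain ⟨hwu, hwT⟩ := mem_erase.1 hw
        exact mem_filter.2 ⟨hTS hwT, hTq huT hwT hwu.symm⟩
      · rw [card_erase_of_mem huT, hTc, Nat.add_sub_cancel]
      · exact hTq.subset (by simp)
  calc _ ≤ _ := card_le_card hsub
    _ ≤ _ := card_union_le _ _
    _ ≤ _ := Nat.add_le_add_left (card_biUnion_le.trans (sum_le_sum fun _ _ => card_image_le)) _

/-- A weighted AM-GM inequality with integer weights `1` and `k`. -/
lemma succ_mul_mul_pow_le {m u : ℝ} (hm : 0 ≤ m) (hu : 0 ≤ u) (k : ℕ) :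
    (k + 1) * m * u ^ k ≤ m ^ (k + 1) + k * u ^ (k + 1) := by
  induction k with
  | zero => simp
  | succ k ih =>
    have hmono : 0 ≤ (m - u) * (m ^ (k + 1) - u ^ (k + 1)) := by
      rcases le_total m u with h | h
      · exact mul_nonneg_of_nonpos_of_nonpos (sub_nonpos.2 h)
          (sub_nonpos.2 (pow_le_pow_left₀ hm h _))
      · exact mul_nonneg (sub_nonneg.2 h) (sub_nonneg.2 (pow_le_pow_left₀ hu h _))
    have hih := mul_le_mul_of_nonneg_left ih hu
    push_cast
    ring_nf at hmono hih ⊢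
    linarith

/-- The optimization step for passing from `L` to `L + 1` classes. -/
lemma choose_mul_pow_add_le (L k : ℕ) {m u : ℝ} (hm : 0 ≤ m) (hu : 0 ≤ u) :
    (L.choose (k + 1) : ℝ) * u ^ (k + 1) + ((L + 1) * m - L * u) * ((L.choose k : ℝ) * u ^ k) ≤
      ((L + 1).choose (k + 1) : ℝ) * m ^ (k + 1) := by
  have hpascal : ((L + 1).choose (k + 1) : ℝ) = L.choose k + L.choose (k + 1) := by
    exact_mod_cast Nat.choose_succ_succ L k
  have habsorb : ((L : ℝ) + 1) * L.choose k = (L + 1).choose (k + 1) * (k + 1) := by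
    exact_mod_cast Nat.add_one_mul_choose_eq L k
  have hk : (0 : ℝ) < k + 1 := by positivity
  have hscaled := mul_le_mul_of_nonneg_left (succ_mul_mul_pow_le hm hu k)
    (Nat.cast_nonneg (α := ℝ) ((L + 1).choose (k + 1)))
  have hnext : (L.choose (k + 1) : ℝ) = (L + 1).choose (k + 1) - L.choose k := by
    rw [hpascal]; ring
  rw [hnext]
  linear_combination hscaled + (m * u ^ k - u ^ (k + 1)) * habsorb

/-- A vertex set without an `(ℓ + 1)`-clique spans at most `(ℓ choose r) (|S| / ℓ) ^ r` cliques
of size `r`. -/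
theorem card_cliquesIn_le {V : Type*} (G : SimpleGraph V) (ℓ : ℕ) :
    ∀ (r : ℕ) (S : Finset V), cliquesIn G S (ℓ + 1) = ∅ →
      ((cliquesIn G S r).card : ℝ) ≤ (ℓ.choose r : ℝ) * ((S.card : ℝ) / ℓ) ^ r := by
  have hzero (S : Finset V) : (cliquesIn G S 0).card ≤ 1 := by
    refine card_le_one.2 fun A hA B hB => ?_
    rw [card_eq_zero.1 (mem_cliquesIn.1 hA).1.2, card_eq_zero.1 (mem_cliquesIn.1 hB).1.2]
  have hsingle (S : Finset V) (h : cliquesIn G S 1 = ∅) : S = ∅ := by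
    refine eq_empty_of_forall_notMem fun v hv => ?_
    have hmem : ({v} : Finset V) ∈ cliquesIn G S 1 := mem_cliquesIn.2 (by simpa using hv)
    simp [h] at hmem
  have hempty (k : ℕ) : cliquesIn G ∅ (k + 1) = ∅ := by
    refine eq_empty_of_forall_notMem fun T hT => ?_
    obtain ⟨⟨hT0, hTc⟩, -⟩ := mem_cliquesIn.1 hT
    simp [subset_empty.1 hT0] at hTc
  induction ℓ with
  | zero =>
    intro r S hS
    cases r with
    | zero => simpa using hzero S
    | succ k => simp [hsingle S hS, hempty k]
  | succ L ih =>
    intro r S hS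
    cases r with
    | zero => simpa using hzero S
    | succ k =>
      rcases S.eq_empty_or_nonempty with rfl | hne
      · simp [hempty k]
      obtain ⟨v, hvS, hmax⟩ := exists_max_image S
        (fun u => (cliquesIn G (neighborsIn G S u) k).card) hne
      set N := neighborsIn G S v with hN
      have hNS : N ⊆ S := filter_subset _ _
      have hNfree : cliquesIn G N (L + 1) = ∅ := by
        refine eq_empty_of_forall_notMem fun T hT => ?_
        obtain ⟨⟨hTN, hTc⟩, hTq⟩ := mem_cliquesIn.1 hT
        have hadj : ∀ w ∈ T, G.Adj v w := fun w hw => (mem_filter.1 (hTN hw)).2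
        have hvT : v ∉ T := fun h => (hadj v h).ne rfl
        have hmem : insert v T ∈ cliquesIn G S (L + 1 + 1) := by
          refine mem_cliquesIn.2 ⟨⟨insert_subset hvS (hTN.trans hNS), ?_⟩, ?_⟩
          · rw [card_insert_of_notMem hvT, hTc]
          · rw [coe_insert]
            exact hTq.insert fun w hw _ => hadj w hw
        simp [hS] at hmem
      have hcount : ((cliquesIn G S (k + 1)).card : ℝ) ≤ (cliquesIn G N (k + 1)).card +
          ((S.card : ℝ) - N.card) * (cliquesIn G N k).card := by
        rw [← cast_card_sdiff hNS]
        have hsum := sum_le_card_nsmul (S \ N) _ _ fun u hu => hmax u (mem_sdiff.1 hu).1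
        rw [smul_eq_mul] at hsum
        exact_mod_cast (card_cliquesIn_succ_le G S N k).trans (Nat.add_le_add_left hsum _)
      have hm : ((L : ℝ) + 1) * ((S.card : ℝ) / (L + 1)) = S.card := by
        field_simp
      have hu : (L : ℝ) * ((N.card : ℝ) / L) = N.card := by
        rcases Nat.eq_zero_or_pos L with rfl | hL
        · simp [hsingle N hNfree]
        · field_simp
      have hopt := choose_mul_pow_add_le L k (m := (S.card : ℝ) / (L + 1))
        (u := (N.card : ℝ) / L) (by positivity) (by positivity)
      rw [hm, hu] at hopt
      have hle : (N.card : ℝ) ≤ S.card := by exact_mod_cast card_le_card hNS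
      push_cast
      exact hcount.trans ((add_le_add (ih _ N hNfree)
        (mul_le_mul_of_nonneg_left (ih _ N hNfree) (sub_nonneg.2 hle))).trans hopt)

theorem stmt_12 (n ℓ r : ℕ) (hr : 2 ≤ r) (hrℓ : r ≤ ℓ)
    (H : Finset (Finset (Fin n))) (hH : ∀ e ∈ H, e.card = r)
    (hfree : KKFree n ℓ H) :
    (H.card : ℝ) ≤ (ℓ.choose r : ℝ) * ((n : ℝ) / (ℓ : ℝ)) ^ r := by
  let G : SimpleGraph (Fin n) :=
    { Adj := fun x y => x ≠ y ∧ ∃ e ∈ H, x ∈ e ∧ y ∈ e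
      symm := ⟨fun _ _ ⟨hne, e, he, hx, hy⟩ => ⟨hne.symm, e, he, hy, hx⟩⟩
      loopless := ⟨fun _ h => h.1 rfl⟩ }
  have hcliques : H ⊆ cliquesIn G univ r := fun e he =>
    mem_cliquesIn.2 ⟨⟨subset_univ _, hH e he⟩, fun _ hx _ hy hne => ⟨hne, e, he, hx, hy⟩⟩
  have hGfree : cliquesIn G univ (ℓ + 1) = ∅ := by
    refine eq_empty_of_forall_notMem fun T hT => ?_
    obtain ⟨⟨-, hTc⟩, hTq⟩ := mem_cliquesIn.1 hT
    exact hfree ⟨T, hTc, fun x hx y hy hne => (hTq hx hy hne).2⟩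
  have hbound := card_cliquesIn_le G ℓ r univ hGfree
  rw [card_univ, Fintype.card_fin] at hbound
  exact le_trans (by exact_mod_cast card_le_card hcliques) hbound
end

section
/- Let H be a cancellative 3-graph on vertex set [n]. Then ∑_{T ∈ ∂H} ∑_{(u,v) ∈ N(T) × N(T)} 1/|L(u,v)| ≤ n² − 2·|∂H|, where the inner sum ranges over all ordered pairs (u,v) of (not necessarily distinct) vertices of N(T). (Note that T ∈ L(u,v) for every (u,v) ∈ N(T) × N(T), so each denominator is at least 1.) -/
open Finset
open scoped Classical

/-- `H` is cancellative: it contains no three distinct edges `A`, `B`, `C`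
with `A △ B ⊆ C`. -/
def Cancellative (n : ℕ) (H : Finset (Finset (Fin n))) : Prop :=
  ∀ A ∈ H, ∀ B ∈ H, ∀ C ∈ H, A ≠ B → A ≠ C → B ≠ C → ¬ (symmDiff A B ⊆ C)

/-- The shadow `∂H`: the family of `2`-element sets contained in some edge of `H`. -/
noncomputable def shadow2 (n : ℕ) (H : Finset (Finset (Fin n))) : Finset (Finset (Fin n)) :=
  Finset.univ.filter fun T => T.card = 2 ∧ ∃ e ∈ H, T ⊆ e

/-- The neighborhood `N(T) = { v : T ∪ {v} ∈ H }`. -/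
noncomputable def nbhd (n : ℕ) (H : Finset (Finset (Fin n))) (T : Finset (Fin n)) :
    Finset (Fin n) :=
  Finset.univ.filter fun v => insert v T ∈ H

/-- The link `L(u,v) = { A ∈ ∂H : A ∪ {u} ∈ H and A ∪ {v} ∈ H }`. -/
noncomputable def link2 (n : ℕ) (H : Finset (Finset (Fin n))) (u v : Fin n) :
    Finset (Finset (Fin n)) :=
  (shadow2 n H).filter fun A => insert u A ∈ H ∧ insert v A ∈ H

/-- Ordered pairs of distinct vertices spanning a shadow pair. -/
noncomputable def shadowPairs (n : ℕ) (H : Finset (Finset (Fin n))) :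
    Finset (Fin n × Fin n) :=
  (shadow2 n H).biUnion Finset.offDiag

theorem eq_pair_of_mem_offDiag {α : Type*} {T : Finset α} (hT : T.card = 2) {p : α × α}
    (hp : p ∈ T.offDiag) : T = {p.1, p.2} := by
  obtain ⟨h1, h2, h3⟩ := Finset.mem_offDiag.1 hp
  refine (Finset.eq_of_subset_of_card_le ?_ ?_).symm
  · simp [Finset.insert_subset_iff, h1, h2]
  · rw [hT, Finset.card_pair h3]

theorem card_shadowPairs (n : ℕ) (H : Finset (Finset (Fin n))) :
    (shadowPairs n H).card = 2 * (shadow2 n H).card := by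
  have hcard : ∀ T ∈ shadow2 n H, T.card = 2 := fun T hT => (Finset.mem_filter.1 hT).2.1
  rw [shadowPairs, Finset.card_biUnion]
  · rw [Finset.sum_congr rfl fun T hT => by rw [Finset.offDiag_card, hcard T hT]]
    simp [mul_comm]
  · intro S hS T hT hne
    refine Finset.disjoint_left.2 fun p hpS hpT => hne ?_
    rw [eq_pair_of_mem_offDiag (hcard S hS) hpS, eq_pair_of_mem_offDiag (hcard T hT) hpT]

/-- In a cancellative 3-graph, two vertices spanning a shadow pair have no common link. -/
theorem link2_eq_empty_of_mem_shadowPairs {n : ℕ} {H : Finset (Finset (Fin n))}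
    (hH : ∀ e ∈ H, e.card = 3) (hc : Cancellative n H) {u v : Fin n}
    (huv : (u, v) ∈ shadowPairs n H) : link2 n H u v = ∅ := by
  obtain ⟨T, hT, hp⟩ := Finset.mem_biUnion.1 huv
  obtain ⟨hu, hv, hne⟩ := Finset.mem_offDiag.1 hp
  obtain ⟨-, -, C, hC, hTC⟩ := Finset.mem_filter.1 hT
  refine Finset.eq_empty_of_forall_notMem fun A hA => ?_
  obtain ⟨hAs, hAu, hAv⟩ := Finset.mem_filter.1 hA
  have hA2 : A.card = 2 := (Finset.mem_filter.1 hAs).2.1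
  have huA : u ∉ A := fun h => by
    have := hH _ hAu
    rw [Finset.insert_eq_of_mem h] at this
    omega
  have hvA : v ∉ A := fun h => by
    have := hH _ hAv
    rw [Finset.insert_eq_of_mem h] at this
    omega
  have huC := hTC hu
  have hvC := hTC hv
  have hv' : v ∉ insert u A := by simp [hvA, Ne.symm hne]
  have hu' : u ∉ insert v A := by simp [huA, hne]
  refine hc _ hAu _ hAv C hC (fun h => hv' (h ▸ Finset.mem_insert_self v A))
    (fun h => hv' (h ▸ hvC)) (fun h => hu' (h ▸ huC)) fun x hx => ?_
  rw [Finset.mem_symmDiff, Finset.mem_insert, Finset.mem_insert] at hx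
  rcases hx with ⟨rfl | h, h'⟩ | ⟨rfl | h, h'⟩
  · exact huC
  · exact absurd (Or.inr h) h'
  · exact hvC
  · exact absurd (Or.inr h) h'

/-- Double counting: the weights of each ordered pair sum to one exactly when its link is
nonempty. -/
theorem sum_one_div_card_link2 (n : ℕ) (H : Finset (Finset (Fin n))) :
    ∑ T ∈ shadow2 n H, ∑ u ∈ nbhd n H T, ∑ v ∈ nbhd n H T,
        (1 : ℝ) / ((link2 n H u v).card : ℝ)
      = ((Finset.univ.filter fun p : Fin n × Fin n => (link2 n H p.1 p.2).Nonempty).card : ℝ) := by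
  have hswap : ∑ T ∈ shadow2 n H, ∑ u ∈ nbhd n H T, ∑ v ∈ nbhd n H T,
        (1 : ℝ) / ((link2 n H u v).card : ℝ)
      = ∑ p : Fin n × Fin n, ∑ _T ∈ link2 n H p.1 p.2,
          (1 : ℝ) / ((link2 n H p.1 p.2).card : ℝ) := by
    simp only [← Finset.sum_product']
    refine Finset.sum_comm' fun T p => ?_
    simp [nbhd, link2]
  rw [hswap, Finset.card_filter, Nat.cast_sum]
  refine Finset.sum_congr rfl fun p _ => ?_
  rcases (link2 n H p.1 p.2).eq_empty_or_nonempty with h | h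
  · simp [h]
  · have : ((link2 n H p.1 p.2).card : ℝ) ≠ 0 := by exact_mod_cast h.card_pos.ne'
    simp [h, this]

theorem stmt_13 (n : ℕ) (H : Finset (Finset (Fin n)))
    (hH : ∀ e ∈ H, e.card = 3) (hc : Cancellative n H) :
    ∑ T ∈ shadow2 n H, ∑ u ∈ nbhd n H T, ∑ v ∈ nbhd n H T,
        (1 : ℝ) / ((link2 n H u v).card : ℝ)
      ≤ (n : ℝ) ^ 2 - 2 * ((shadow2 n H).card : ℝ) := by
  have hdisj : Disjoint
      (Finset.univ.filter fun p : Fin n × Fin n => (link2 n H p.1 p.2).Nonempty)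
      (shadowPairs n H) := by
    refine Finset.disjoint_left.2 fun p hp hps => ?_
    exact (Finset.mem_filter.1 hp).2.ne_empty (link2_eq_empty_of_mem_shadowPairs hH hc hps)
  have hle := Finset.card_le_univ
    ((Finset.univ.filter fun p : Fin n × Fin n => (link2 n H p.1 p.2).Nonempty) ∪ shadowPairs n H)
  rw [Finset.card_union_of_disjoint hdisj, card_shadowPairs, Fintype.card_prod, Fintype.card_fin,
    ← sq] at hle
  rw [sum_one_div_card_link2, le_sub_iff_add_le]
  exact_mod_cast hle
end

section
/- Let H be a cancellative 3-graph on vertex set [n] with n ≥ 3. Then ∑_{T ∈ ∂H} 4·( d(T)/(n − d(T)) )² ≤ n² − 2·|∂H|, where for every T ∈ ∂H one has d(T) ≤ n − 2 (so each denominator is positive). -/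
open Finset
open scoped Classical

/-- The number of pairs of `L` through `a` is at most the number of neighbours of `a`. -/
theorem card_pairs_through_le {α : Type*} [Fintype α] [DecidableEq α] (L : Finset (Finset α))
    (hL : ∀ T ∈ L, T.card = 2) (a : α) :
    (L.filter fun T => a ∈ T).card ≤ (univ.filter fun c => ({a, c} : Finset α) ∈ L).card := by
  refine (card_le_card (t := (univ.filter fun c => ({a, c} : Finset α) ∈ L).image
    fun c => ({a, c} : Finset α)) fun T hT => ?_).trans card_image_le
  obtain ⟨hT, ha⟩ := mem_filter.1 hT
  obtain ⟨x, y, -, rfl⟩ := card_eq_two.1 (hL T hT)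
  simp only [mem_image, mem_filter, mem_univ, true_and]
  rcases mem_insert.1 ha with rfl | h
  · exact ⟨y, hT, rfl⟩
  · obtain rfl := mem_singleton.1 h
    exact ⟨x, by rwa [pair_comm], pair_comm _ _⟩

/-- Double counting of incidences between the pairs of `L` and their vertices. -/
theorem sum_sum_mem_comm {α : Type*} [DecidableEq α] (L : Finset (Finset α)) (S : Finset α)
    (hS : ∀ T ∈ L, T ⊆ S) (f : α → ℕ) :
    ∑ T ∈ L, ∑ a ∈ T, f a = ∑ a ∈ S, (L.filter fun T => a ∈ T).card * f a := by
  rw [sum_comm' (t' := S) (s' := fun a => L.filter fun T => a ∈ T)]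
  · simp
  · intro T a
    simp only [mem_filter]
    exact ⟨fun h => ⟨h, hS T h.1 h.2⟩, fun h => h.1⟩

/-- Mantel's theorem for a triangle-free family of pairs inside `S`. -/
theorem four_mul_card_le_sq_of_triangleFree {α : Type*} [Fintype α] [DecidableEq α] (L : Finset (Finset α))
    (S : Finset α) (hL : ∀ T ∈ L, T.card = 2) (hS : ∀ T ∈ L, T ⊆ S)
    (htri : ∀ a b c : α, ({a, b} : Finset α) ∈ L → ({a, c} : Finset α) ∈ L →
      ({b, c} : Finset α) ∉ L) :
    4 * L.card ≤ S.card ^ 2 := by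
  set deg : α → ℕ := fun a => (L.filter fun T => a ∈ T).card with hdeg
  have hsum : ∑ a ∈ S, deg a = 2 * L.card := by
    have h := sum_sum_mem_comm L S hS fun _ => 1
    simp only [mul_one, ← card_eq_sum_ones] at h
    rw [← h, sum_congr rfl hL, sum_const, smul_eq_mul, mul_comm]
  have hsq : ∑ a ∈ S, deg a ^ 2 ≤ L.card * S.card := by
    have h := sum_sum_mem_comm L S hS deg
    simp only [sq]
    rw [← h, ← smul_eq_mul]
    refine sum_le_card_nsmul _ _ _ fun T hT => ?_
    obtain ⟨a, b, hab, rfl⟩ := card_eq_two.1 (hL T hT)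
    rw [sum_pair hab]
    refine (add_le_add (card_pairs_through_le L hL a) (card_pairs_through_le L hL b)).trans ?_
    rw [← card_union_of_disjoint]
    · refine card_le_card fun c hc => ?_
      simp only [mem_union, mem_filter, mem_univ, true_and] at hc
      rcases hc with hc | hc <;> exact hS _ hc (by simp)
    · rw [disjoint_left]
      intro c h1 h2
      exact htri a b c hT (mem_filter.1 h1).2 (mem_filter.1 h2).2
  have hcs := sq_sum_le_card_mul_sum_sq (s := S) (f := deg)
  rw [hsum] at hcs
  rcases Nat.eq_zero_or_pos L.card with h0 | hpos
  · simp [h0]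
  · refine Nat.le_of_mul_le_mul_left ?_ hpos
    nlinarith [Nat.mul_le_mul_left S.card hsq]

theorem notMem_of_mem_nbhd {n : ℕ} {H : Finset (Finset (Fin n))} (hH : ∀ e ∈ H, e.card = 3)
    {T : Finset (Fin n)} (hT : T.card = 2) {v : Fin n} (hv : v ∈ nbhd n H T) : v ∉ T := by
  intro h
  have h3 := hH _ (mem_filter.1 hv).2
  rw [insert_eq_of_mem h] at h3
  omega

theorem card_nbhd_le {n : ℕ} {H : Finset (Finset (Fin n))} (hH : ∀ e ∈ H, e.card = 3)
    {T : Finset (Fin n)} (hT : T.card = 2) : (nbhd n H T).card ≤ n - 2 := by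
  have hd : Disjoint (nbhd n H T) T :=
    disjoint_left.2 fun v hv => notMem_of_mem_nbhd hH hT hv
  have h := card_le_univ (nbhd n H T ∪ T)
  rw [card_union_of_disjoint hd, Fintype.card_fin] at h
  omega

/-- The neighbourhood of a pair is independent in the shadow. -/
theorem pair_notMem_shadow2 {n : ℕ} {H : Finset (Finset (Fin n))} (hH : ∀ e ∈ H, e.card = 3)
    (hc : Cancellative n H) {T : Finset (Fin n)} (hT : T.card = 2) {x y : Fin n}
    (hx : x ∈ nbhd n H T) (hy : y ∈ nbhd n H T) : ({x, y} : Finset (Fin n)) ∉ shadow2 n H := by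
  intro h
  obtain ⟨h2, C, hC, hsub⟩ := (mem_filter.1 h).2
  have hxT := notMem_of_mem_nbhd hH hT hx
  have hyT := notMem_of_mem_nbhd hH hT hy
  have hxy : x ≠ y := by
    rintro rfl
    simp at h2
  have hyA : y ∉ insert x T := by simp [hxy.symm, hyT]
  have hxB : x ∉ insert y T := by simp [hxy, hxT]
  have hxC : x ∈ C := hsub (by simp)
  have hyC : y ∈ C := hsub (by simp)
  refine hc _ (mem_filter.1 hx).2 _ (mem_filter.1 hy).2 C hC ?_ ?_ ?_ ?_
  · intro e
    exact hxB (e ▸ mem_insert_self x T)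
  · intro e
    exact hyA (e ▸ hyC)
  · intro e
    exact hxB (e ▸ hxC)
  · intro z hz
    simp only [mem_symmDiff, mem_insert] at hz
    have : z = x ∨ z = y := by tauto
    rcases this with rfl | rfl <;> assumption

/-- Links in a cancellative `3`-graph are triangle-free. -/
theorem link_triangleFree {n : ℕ} {H : Finset (Finset (Fin n))} (hH : ∀ e ∈ H, e.card = 3)
    (hc : Cancellative n H) {x a b c : Fin n} (hab : insert x {a, b} ∈ H)
    (hac : insert x {a, c} ∈ H) : insert x {b, c} ∉ H := by
  intro hbc
  have ne : ∀ p q : Fin n, insert x {p, q} ∈ H → x ≠ p ∧ x ≠ q ∧ p ≠ q :=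
    fun p q h => by
      have h3 := hH _ h
      refine ⟨?_, ?_, ?_⟩ <;> rintro rfl
      · have := card_le_two (a := x) (b := q)
        simp at h3
        omega
      · have := card_le_two (a := p) (b := x)
        simp at h3
        omega
      · have := card_le_two (a := x) (b := p)
        simp at h3
        omega
  obtain ⟨h1, h2, h3⟩ := ne a b hab
  obtain ⟨-, h4, h5⟩ := ne a c hac
  obtain ⟨-, -, h6⟩ := ne b c hbc
  have haC : a ∉ insert x ({b, c} : Finset (Fin n)) := by simp [h1.symm, h3, h5]
  refine hc _ hab _ hac _ hbc ?_ ?_ ?_ ?_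
  · intro e
    have : b ∈ insert x ({a, c} : Finset (Fin n)) := e ▸ (by simp)
    simp [h2.symm, h3.symm, h6] at this
  · intro e
    exact haC (e ▸ (by simp))
  · intro e
    exact haC (e ▸ (by simp))
  · intro z hz
    simp only [mem_symmDiff, mem_insert, mem_singleton] at hz ⊢
    tauto

/-- The weighted sum over the link of `x` is at most the number of vertices that are not
adjacent to `x` in the shadow. -/
theorem sum_link_le {n : ℕ} {H : Finset (Finset (Fin n))} (hH : ∀ e ∈ H, e.card = 3)
    (hc : Cancellative n H) (x : Fin n) :
    ∑ T ∈ (shadow2 n H).filter (fun T => x ∈ nbhd n H T),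
        4 * ((nbhd n H T).card : ℝ) / ((n : ℝ) - ((nbhd n H T).card : ℝ)) ^ 2
      ≤ (n : ℝ) - ((univ.filter fun y => ({x, y} : Finset (Fin n)) ∈ shadow2 n H).card : ℝ) := by
  set S := univ.filter fun y => ({x, y} : Finset (Fin n)) ∈ shadow2 n H with hSdef
  set L := (shadow2 n H).filter (fun T => x ∈ nbhd n H T) with hLdef
  have hL2 : ∀ T ∈ L, T.card = 2 := fun T hT => (mem_filter.1 (mem_filter.1 hT).1).2.1
  have hLx : ∀ T ∈ L, x ∈ nbhd n H T := fun T hT => (mem_filter.1 hT).2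
  have hLH : ∀ T ∈ L, insert x T ∈ H := fun T hT => (mem_filter.1 (hLx T hT)).2
  have hLS : ∀ T ∈ L, T ⊆ S := by
    intro T hT a ha
    have hxT := notMem_of_mem_nbhd hH (hL2 T hT) (hLx T hT)
    have hxa : x ≠ a := by
      rintro rfl
      exact hxT ha
    refine mem_filter.2 ⟨mem_univ _, mem_filter.2 ⟨mem_univ _, card_pair hxa, _, hLH T hT, ?_⟩⟩
    exact insert_subset_insert _ (singleton_subset_iff.2 ha)
  have hMantel : (4 * L.card : ℝ) ≤ (S.card : ℝ) ^ 2 := by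
    exact_mod_cast four_mul_card_le_sq_of_triangleFree L S hL2 hLS fun a b c hab hac hbc =>
      link_triangleFree hH hc (hLH _ hab) (hLH _ hac) (hLH _ hbc)
  have hdeg : ∀ T ∈ L, ((nbhd n H T).card : ℝ) + S.card ≤ n := by
    intro T hT
    have hd : Disjoint (nbhd n H T) S := disjoint_left.2 fun y hy hyS =>
      pair_notMem_shadow2 hH hc (hL2 T hT) (hLx T hT) hy (mem_filter.1 hyS).2
    have h := card_le_univ (nbhd n H T ∪ S)
    rw [card_union_of_disjoint hd, Fintype.card_fin] at h
    exact_mod_cast h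
  have hSn : (S.card : ℝ) ≤ n := by
    have h := card_le_univ S
    rw [Fintype.card_fin] at h
    exact_mod_cast h
  rcases L.eq_empty_or_nonempty with h0 | ⟨T₀, hT₀⟩
  · rw [h0, sum_empty]
    linarith
  have hSpos : (0 : ℝ) < S.card := by
    have h := card_le_card (hLS T₀ hT₀)
    rw [hL2 T₀ hT₀] at h
    exact_mod_cast (by omega : 0 < S.card)
  have hterm : ∀ T ∈ L, 4 * ((nbhd n H T).card : ℝ) / ((n : ℝ) - ((nbhd n H T).card : ℝ)) ^ 2
      ≤ 4 * ((n : ℝ) - S.card) / (S.card : ℝ) ^ 2 := by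
    intro T hT
    have h := hdeg T hT
    have hn : (0 : ℝ) ≤ (n : ℝ) - S.card := by linarith
    gcongr <;> linarith
  refine (sum_le_card_nsmul _ _ _ hterm).trans ?_
  rw [nsmul_eq_mul, ← mul_div_assoc, div_le_iff₀ (by positivity)]
  nlinarith [mul_le_mul_of_nonneg_left hMantel (sub_nonneg.2 hSn)]

theorem stmt_14 (n : ℕ) (hn : 3 ≤ n) (H : Finset (Finset (Fin n)))
    (hH : ∀ e ∈ H, e.card = 3) (hc : Cancellative n H) :
    (∀ T ∈ shadow2 n H, (nbhd n H T).card ≤ n - 2) ∧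
    ∑ T ∈ shadow2 n H,
        4 * (((nbhd n H T).card : ℝ) / ((n : ℝ) - ((nbhd n H T).card : ℝ))) ^ 2
      ≤ (n : ℝ) ^ 2 - 2 * ((shadow2 n H).card : ℝ) := by
  have h2 : ∀ T ∈ shadow2 n H, T.card = 2 := fun T hT => (mem_filter.1 hT).2.1
  refine ⟨fun T hT => card_nbhd_le hH (h2 T hT), ?_⟩
  have hswap : ∑ T ∈ shadow2 n H,
        4 * (((nbhd n H T).card : ℝ) / ((n : ℝ) - ((nbhd n H T).card : ℝ))) ^ 2
      = ∑ x : Fin n, ∑ T ∈ (shadow2 n H).filter (fun T => x ∈ nbhd n H T),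
        4 * ((nbhd n H T).card : ℝ) / ((n : ℝ) - ((nbhd n H T).card : ℝ)) ^ 2 := by
    rw [← sum_comm' (s := shadow2 n H) (t := fun T => nbhd n H T)]
    · refine sum_congr rfl fun T _ => ?_
      rw [sum_const, nsmul_eq_mul, div_pow]
      ring
    · intro T x
      simp
  have hdeg : 2 * (shadow2 n H).card
      ≤ ∑ x : Fin n, (univ.filter fun y => ({x, y} : Finset (Fin n)) ∈ shadow2 n H).card := by
    have h := sum_sum_mem_comm (shadow2 n H) univ (fun T _ => subset_univ T) fun _ => 1
    simp only [mul_one, ← card_eq_sum_ones] at h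
    rw [sum_congr rfl h2, sum_const, smul_eq_mul, mul_comm] at h
    rw [h]
    exact sum_le_sum fun x _ => card_pairs_through_le _ h2 x
  have hdeg' : (2 * (shadow2 n H).card : ℝ)
      ≤ ∑ x : Fin n, ((univ.filter fun y => ({x, y} : Finset (Fin n)) ∈ shadow2 n H).card : ℝ) := by
    exact_mod_cast hdeg
  rw [hswap]
  refine (sum_le_sum fun x _ => sum_link_le hH hc x).trans ?_
  rw [sum_sub_distrib, sum_const, card_univ, Fintype.card_fin, nsmul_eq_mul, ← sq]
  linarith
end

section
/- For every ε with 0 < ε < 1/100 there exists n₀ such that for all n ≥ n₀ the following holds: if H is a cancellative 3-graph on [n] with at least (1−ε)·t_3(n,3) edges, then there exists T ∈ ∂H such that ∑_{(u,v) ∈ N(T) × N(T)} |L(u,v)| ≥ (1 − 100ε)·d(T)²·((n − d(T))/2)², where the sum ranges over all ordered pairs (u,v) of (not necessarily distinct) vertices of N(T). -/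
open Finset
open scoped Classical

/-- `t3 n = t_3(n,3) = ⌊n/3⌋·⌊(n+1)/3⌋·⌊(n+2)/3⌋`. -/
def t3 (n : ℕ) : ℕ := (n / 3) * ((n + 1) / 3) * ((n + 2) / 3)

theorem two_mul_card_shadow2_le (n : ℕ) (H : Finset (Finset (Fin n))) :
    2 * #(shadow2 n H) ≤
      #(univ.filter fun p : Fin n × Fin n => ({p.1, p.2} : Finset (Fin n)) ∈ shadow2 n H) := by
  rw [Finset.card_eq_sum_card_fiberwise (f := fun p : Fin n × Fin n => ({p.1, p.2} : Finset (Fin n)))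
    (t := shadow2 n H) (fun p hp => by simpa using hp), mul_comm, ← smul_eq_mul]
  refine Finset.card_nsmul_le_sum _ _ _ fun T hT => ?_
  obtain ⟨a, b, hab, rfl⟩ := Finset.card_eq_two.mp (by simpa [shadow2] using hT :
    #T = 2 ∧ ∃ e ∈ H, T ⊆ e).1
  rw [← Finset.card_pair (a := (a, b)) (b := (b, a)) (by simp [hab])]
  refine Finset.card_le_card fun p hp => ?_
  rcases Finset.mem_insert.mp hp with rfl | hp
  · simpa using hT
  · obtain rfl := Finset.mem_singleton.mp hp
    simpa [Finset.pair_comm b a] using hT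

theorem notMem_of_insert_mem {n : ℕ} {H : Finset (Finset (Fin n))} (h3 : ∀ e ∈ H, e.card = 3)
    {A : Finset (Fin n)} (hA : A ∈ shadow2 n H) {u : Fin n} (hu : insert u A ∈ H) : u ∉ A := by
  intro h
  have hA2 : A.card = 2 := (Finset.mem_filter.mp hA).2.1
  have := h3 _ hu
  rw [Finset.insert_eq_of_mem h] at this
  omega

theorem sum_card_nbhd (n : ℕ) (H : Finset (Finset (Fin n))) (h3 : ∀ e ∈ H, e.card = 3) :
    ∑ A ∈ shadow2 n H, #(nbhd n H A) = 3 * #H := by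
  have hH : ∑ e ∈ H, #e = 3 * #H := by
    rw [Finset.sum_congr rfl h3, Finset.sum_const, smul_eq_mul, mul_comm]
  rw [← hH, ← Finset.card_sigma, ← Finset.card_sigma]
  refine Finset.card_bij' (fun p _ => ⟨insert p.2 p.1, p.2⟩) (fun p _ => ⟨p.1.erase p.2, p.2⟩)
    ?_ ?_ ?_ ?_
  · rintro ⟨A, u⟩ h
    simp only [Finset.mem_sigma, nbhd, Finset.mem_filter, Finset.mem_univ, true_and] at h ⊢
    exact ⟨h.2, Finset.mem_insert_self _ _⟩
  · rintro ⟨e, u⟩ h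
    simp only [Finset.mem_sigma, nbhd, shadow2, Finset.mem_filter, Finset.mem_univ,
      true_and] at h ⊢
    refine ⟨⟨?_, e, h.1, Finset.erase_subset _ _⟩, by rw [Finset.insert_erase h.2]; exact h.1⟩
    rw [Finset.card_erase_of_mem h.2, h3 e h.1]
  · rintro ⟨A, u⟩ h
    simp only [Finset.mem_sigma, nbhd, Finset.mem_filter, Finset.mem_univ, true_and] at h
    simp only [Finset.erase_insert (notMem_of_insert_mem h3 h.1 h.2)]
  · rintro ⟨e, u⟩ h
    simp only [Finset.mem_sigma] at h
    simp only [Finset.insert_erase h.2]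

theorem link2_eq_empty {n : ℕ} {H : Finset (Finset (Fin n))} (h3 : ∀ e ∈ H, e.card = 3)
    (hc : Cancellative n H) {u v : Fin n} (huv : ({u, v} : Finset (Fin n)) ∈ shadow2 n H) :
    link2 n H u v = ∅ := by
  obtain ⟨hcard, e, he, hsub⟩ := (Finset.mem_filter.mp huv).2
  have hne : u ≠ v := fun h => by simp [h] at hcard
  refine Finset.eq_empty_of_forall_notMem fun A hA => ?_
  obtain ⟨hA, hu, hv⟩ := Finset.mem_filter.mp hA
  have huA := notMem_of_insert_mem h3 hA hu
  have hvA := notMem_of_insert_mem h3 hA hv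
  have hue : u ∈ e := hsub (by simp)
  have hve : v ∈ e := hsub (by simp)
  refine hc _ hu _ hv _ he ?_ ?_ ?_ ?_
  · intro h
    have : u ∈ insert v A := h ▸ Finset.mem_insert_self u A
    simp_all
  · rintro rfl
    simp_all
  · rintro rfl
    simp_all
  · intro x hx
    simp only [Finset.mem_symmDiff, Finset.mem_insert] at hx
    rcases hx with ⟨rfl | h, h'⟩ | ⟨rfl | h, h'⟩
    · exact hue
    · exact absurd (Or.inr h) h'
    · exact hve
    · exact absurd (Or.inr h) h'

theorem sum_nbhd_eq_sum_link2 (n : ℕ) (H : Finset (Finset (Fin n))) (g : Fin n → Fin n → ℝ) :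
    ∑ T ∈ shadow2 n H, ∑ u ∈ nbhd n H T, ∑ v ∈ nbhd n H T, g u v =
      ∑ p : Fin n × Fin n, (#(link2 n H p.1 p.2) : ℝ) * g p.1 p.2 := by
  have h : ∀ T ∈ shadow2 n H, ∑ u ∈ nbhd n H T, ∑ v ∈ nbhd n H T, g u v =
      ∑ p : Fin n × Fin n, if insert p.1 T ∈ H ∧ insert p.2 T ∈ H then g p.1 p.2 else 0 :=
    fun T _ => by
      rw [← Finset.sum_product', ← Finset.sum_filter]
      exact Finset.sum_congr (by ext p; simp [nbhd]) fun _ _ => rfl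
  rw [Finset.sum_congr rfl h, Finset.sum_comm]
  refine Finset.sum_congr rfl fun p _ => ?_
  rw [← Finset.sum_filter, Finset.sum_const, nsmul_eq_mul, link2]

/-- Cauchy–Schwarz lower bound for the total of the link sums over the shadow. -/
theorem card_pow_four_le (n : ℕ) (H : Finset (Finset (Fin n))) (h3 : ∀ e ∈ H, e.card = 3)
    (hc : Cancellative n H) :
    2187 * (#H : ℝ) ^ 4 ≤ (n : ℝ) ^ 6 *
      ∑ T ∈ shadow2 n H, ∑ u ∈ nbhd n H T, ∑ v ∈ nbhd n H T, (#(link2 n H u v) : ℝ) := by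
  rw [sum_nbhd_eq_sum_link2 n H fun u v => (#(link2 n H u v) : ℝ)]
  set s : ℝ := (#(shadow2 n H) : ℝ) with hs
  set D : ℝ := ∑ A ∈ shadow2 n H, (#(nbhd n H A) : ℝ) ^ 2 with hD
  set P := univ.filter fun p : Fin n × Fin n => ({p.1, p.2} : Finset (Fin n)) ∉ shadow2 n H with hP
  have hzero : ∀ p : Fin n × Fin n, p ∉ P → link2 n H p.1 p.2 = ∅ := fun p hp =>
    link2_eq_empty h3 hc (by simpa [P] using hp)
  have hPcard : (#P : ℝ) ≤ (n : ℝ) ^ 2 - 2 * s := by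
    have h1 := two_mul_card_shadow2_le n H
    have h2 := Finset.card_filter_add_card_filter_not (s := (univ : Finset (Fin n × Fin n)))
      (fun p => ({p.1, p.2} : Finset (Fin n)) ∈ shadow2 n H)
    simp only [Finset.card_univ, Fintype.card_prod, Fintype.card_fin] at h2
    have hP2 : #P + 2 * #(shadow2 n H) ≤ n * n := by rw [hP]; omega
    have : (#P : ℝ) + 2 * s ≤ n * n := by rw [hs]; exact_mod_cast hP2
    linarith
  have hH : (3 * #H : ℝ) ^ 2 ≤ s * D := by
    have h := sq_sum_le_card_mul_sum_sq (s := shadow2 n H) (f := fun A => (#(nbhd n H A) : ℝ))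
    have h' : ∑ A ∈ shadow2 n H, (#(nbhd n H A) : ℝ) = 3 * #H := by
      exact_mod_cast sum_card_nbhd n H h3
    rwa [h'] at h
  have hDsum : D = ∑ p ∈ P, (#(link2 n H p.1 p.2) : ℝ) := by
    have h := sum_nbhd_eq_sum_link2 n H fun _ _ => 1
    simp only [Finset.sum_const, nsmul_eq_mul, mul_one] at h
    rw [hD, Finset.sum_congr rfl fun A _ => sq (#(nbhd n H A) : ℝ), h]
    exact (Finset.sum_subset (Finset.subset_univ P) fun p _ hp => by simp [hzero p hp]).symm
  set S : ℝ := ∑ p : Fin n × Fin n, (#(link2 n H p.1 p.2) : ℝ) * #(link2 n H p.1 p.2) with hS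
  have hS0 : 0 ≤ S := Finset.sum_nonneg fun p _ => by positivity
  have hDS : D ^ 2 ≤ ((n : ℝ) ^ 2 - 2 * s) * S := by
    have h := sq_sum_le_card_mul_sum_sq (s := P) (f := fun p => (#(link2 n H p.1 p.2) : ℝ))
    rw [← hDsum] at h
    refine h.trans ((mul_le_mul_of_nonneg_right hPcard (Finset.sum_nonneg fun p _ => by
      positivity)).trans_eq ?_)
    rw [hS, Finset.sum_congr rfl fun p _ => sq (#(link2 n H p.1 p.2) : ℝ)]
    congr 1
    exact Finset.sum_subset (Finset.subset_univ P) fun p _ hp => by simp [hzero p hp]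
  have hs0 : 0 ≤ s := by positivity
  have h4 : (3 * #H : ℝ) ^ 4 ≤ s ^ 2 * (((n : ℝ) ^ 2 - 2 * s) * S) := by
    calc (3 * #H : ℝ) ^ 4 = ((3 * #H : ℝ) ^ 2) ^ 2 := by ring
      _ ≤ (s * D) ^ 2 := by gcongr
      _ = s ^ 2 * D ^ 2 := by ring
      _ ≤ _ := by gcongr
  have hamgm : 27 * (s ^ 2 * ((n : ℝ) ^ 2 - 2 * s)) ≤ (n : ℝ) ^ 6 := by
    have : (n : ℝ) ^ 6 - 27 * (s ^ 2 * ((n : ℝ) ^ 2 - 2 * s)) =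
      ((n : ℝ) ^ 2 - 3 * s) ^ 2 * ((n : ℝ) ^ 2 + 6 * s) := by ring
    have : 0 ≤ ((n : ℝ) ^ 2 - 3 * s) ^ 2 * ((n : ℝ) ^ 2 + 6 * s) := by positivity
    linarith
  nlinarith [mul_le_mul_of_nonneg_right hamgm hS0]

theorem mul_sub_sq_le {d n : ℝ} (hn : 0 ≤ n) (hd : d ≤ n) :
    27 * (d * (n - d) ^ 2) ≤ 4 * n ^ 3 := by
  have : 0 ≤ (n - 3 * d) ^ 2 * (4 * n - 3 * d) :=
    mul_nonneg (sq_nonneg _) (by linarith)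
  linarith

theorem sub_two_pow_three_le_t3 {n : ℕ} (hn : 2 ≤ n) : ((n : ℝ) - 2) ^ 3 ≤ 27 * t3 n := by
  have h2 : (0 : ℝ) ≤ n - 2 := by
    have : (2 : ℝ) ≤ n := by exact_mod_cast hn
    linarith
  have key : ∀ m, n ≤ m → (n : ℝ) - 2 ≤ 3 * ((m / 3 : ℕ) : ℝ) := fun m hm => by
    have : n ≤ 3 * (m / 3) + 2 := by omega
    have : (n : ℝ) ≤ 3 * ((m / 3 : ℕ) : ℝ) + 2 := by exact_mod_cast this
    linarith
  calc ((n : ℝ) - 2) ^ 3 = (n - 2) * (n - 2) * (n - 2) := by ring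
    _ ≤ (3 * ((n / 3 : ℕ) : ℝ)) * (3 * (((n + 1) / 3 : ℕ) : ℝ)) *
        (3 * (((n + 2) / 3 : ℕ) : ℝ)) := by
      gcongr
      exacts [key _ le_rfl, key _ (by omega), key _ (by omega)]
    _ = 27 * t3 n := by
      rw [t3]
      push_cast
      ring

theorem stmt_15 (ε : ℝ) (hε0 : 0 < ε) (hε1 : ε < 1 / 100) :
    ∃ n₀ : ℕ, ∀ n : ℕ, n₀ ≤ n → ∀ H : Finset (Finset (Fin n)),
      (∀ e ∈ H, e.card = 3) → Cancellative n H →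
      (1 - ε) * (t3 n : ℝ) ≤ (H.card : ℝ) →
      ∃ T ∈ shadow2 n H,
        (1 - 100 * ε) * ((nbhd n H T).card : ℝ) ^ 2 *
            (((n : ℝ) - ((nbhd n H T).card : ℝ)) / 2) ^ 2
          ≤ ∑ u ∈ nbhd n H T, ∑ v ∈ nbhd n H T, ((link2 n H u v).card : ℝ) := by
  obtain ⟨n₀, hn₀⟩ := exists_nat_ge (6 / ε)
  refine ⟨n₀ + 2, fun n hn H h3 hc hH => ?_⟩
  have hn2 : (2 : ℝ) ≤ n := by exact_mod_cast (by omega : 2 ≤ n)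
  have hεn : 6 ≤ ε * n := by
    have : (n₀ : ℝ) ≤ n := by exact_mod_cast (by omega : n₀ ≤ n)
    rw [mul_comm]
    exact (div_le_iff₀ hε0).mp (hn₀.trans this)
  have hcard : (1 - 2 * ε) * (n : ℝ) ^ 3 ≤ 27 * #H := by
    have h := sub_two_pow_three_le_t3 (n := n) (by omega)
    have h1 : (1 - ε) * ((n : ℝ) - 2) ^ 3 ≤ (1 - ε) * (27 * t3 n) :=
      mul_le_mul_of_nonneg_left h (by linarith)
    have h2 : (n : ℝ) ^ 3 - 6 * (n : ℝ) ^ 2 ≤ ((n : ℝ) - 2) ^ 3 := by nlinarith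
    have hmul : (1 - ε) * ((n : ℝ) ^ 3 - 6 * (n : ℝ) ^ 2) ≤ (1 - ε) * ((n : ℝ) - 2) ^ 3 :=
      mul_le_mul_of_nonneg_left h2 (by linarith)
    have h4 : 6 * (n : ℝ) ^ 2 ≤ ε * n * (n : ℝ) ^ 2 := by gcongr
    have h5 : 0 ≤ ε * (6 * (n : ℝ) ^ 2) := by positivity
    linarith
  have hHpos : (0 : ℝ) < #H := by
    have : 0 < (1 - 2 * ε) * (n : ℝ) ^ 3 := mul_pos (by linarith) (by positivity)
    linarith
  by_contra! hcon
  have hsum : ∑ T ∈ shadow2 n H, ∑ u ∈ nbhd n H T, ∑ v ∈ nbhd n H T, (#(link2 n H u v) : ℝ) ≤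
      (1 - 100 * ε) * (n : ℝ) ^ 3 / 9 * #H := by
    have hd : ∑ T ∈ shadow2 n H, (#(nbhd n H T) : ℝ) = 3 * #H := by
      exact_mod_cast sum_card_nbhd n H h3
    calc _ ≤ ∑ T ∈ shadow2 n H, (1 - 100 * ε) * (n : ℝ) ^ 3 / 27 * #(nbhd n H T) :=
          Finset.sum_le_sum fun T hT => (hcon T hT).le.trans ?_
      _ = _ := by rw [← Finset.mul_sum, hd]; ring
    have hle : (#(nbhd n H T) : ℝ) ≤ n := by
      exact_mod_cast (Finset.card_le_univ _).trans_eq (Fintype.card_fin n)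
    have h := mul_le_mul_of_nonneg_left (mul_sub_sq_le (by linarith) hle)
      (mul_nonneg (by linarith : 0 ≤ 1 - 100 * ε) (Nat.cast_nonneg (α := ℝ) #(nbhd n H T)))
    linarith
  have hn6 : (0 : ℝ) ≤ (n : ℝ) ^ 6 := by positivity
  have h4 := (card_pow_four_le n H h3 hc).trans (mul_le_mul_of_nonneg_left hsum hn6)
  have h5 : (27 * #H : ℝ) ^ 3 ≤ (1 - 100 * ε) * ((n : ℝ) ^ 3) ^ 3 := by
    refine le_of_mul_le_mul_right ?_ hHpos
    linarith
  have h6 : ((1 - 2 * ε) * (n : ℝ) ^ 3) ^ 3 ≤ (27 * #H : ℝ) ^ 3 :=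
    pow_le_pow_left₀ (mul_nonneg (by linarith) (by positivity)) hcard 3
  rw [mul_pow] at h6
  have h7 : (1 - 2 * ε) ^ 3 ≤ 1 - 100 * ε :=
    le_of_mul_le_mul_right (h6.trans h5) (by positivity)
  nlinarith [mul_pos hε0 hε0, mul_pos (mul_pos hε0 hε0) hε0]
end

section
/- Let ℓ ≥ r ≥ 2 and let G be an n-vertex K_{ℓ+1}-free simple graph. Then the number of r-element cliques of G is at most t_r(n,ℓ). -/
open Finset
open scoped Classical

/-- `turanCount n ℓ r` is `t_r(n,ℓ)`: the number of `r`-element subsets of `[n]`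
that meet each class of the balanced partition of `[n]` into `ℓ` parts
(given by residues modulo `ℓ`) in at most one vertex. -/
def turanCount (n ℓ r : ℕ) : ℕ :=
  ((Finset.univ : Finset (Finset (Fin n))).filter
    (fun A => A.card = r ∧ ∀ x ∈ A, ∀ y ∈ A, x ≠ y → x.val % ℓ ≠ y.val % ℓ)).card

open Polynomial in
/-- The generating polynomial `∏ i, (1 + a i X)`; its `r`-th coefficient is the number of
`r`-cliques in the complete multipartite graph with part sizes `a i`. -/
noncomputable def partPoly {ι : Type*} (s : Finset ι) (a : ι → ℕ) : ℕ[X] :=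
  ∏ i ∈ s, (1 + C (a i) * X)

open Polynomial in
/-- Moving one vertex from a part to a smaller part does not decrease any coefficient. -/
lemma partPoly_coeff_le_of_move {ι : Type*} {s : Finset ι} {a a' : ι → ℕ} {i j : ι}
    (hi : i ∈ s) (hj : j ∈ s) (hij : i ≠ j) (hai : a i = a' i + 1) (haj : a' j = a j + 1)
    (hlt : a j < a i) (hother : ∀ k, k ≠ i → k ≠ j → a' k = a k) (r : ℕ) :
    (partPoly s a).coeff r ≤ (partPoly s a').coeff r := by
  have hj' : j ∈ s.erase i := mem_erase.2 ⟨hij.symm, hj⟩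
  have hQ : ∏ k ∈ (s.erase i).erase j, (1 + C (a' k) * X) =
      ∏ k ∈ (s.erase i).erase j, (1 + C (a k) * X : ℕ[X]) := by
    refine prod_congr rfl fun k hk => ?_
    simp only [mem_erase] at hk
    rw [hother k hk.2.1 hk.1]
  obtain ⟨δ, hδ⟩ : ∃ δ, a' i = a j + δ := ⟨a' i - a j, by omega⟩
  unfold partPoly
  rw [← mul_prod_erase _ _ hi, ← mul_prod_erase _ _ hj', ← mul_prod_erase s _ hi,
    ← mul_prod_erase _ _ hj', hQ, hai, haj, hδ]
  generalize ∏ k ∈ (s.erase i).erase j, (1 + C (a k) * X : ℕ[X]) = Q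
  have key : (1 + C (a j + δ) * X) * ((1 + C (a j + 1) * X) * Q) =
      (1 + C (a j + δ + 1) * X) * ((1 + C (a j) * X) * Q) + C δ * X ^ 2 * Q := by
    simp only [map_add, map_one]
    ring
  rw [key, coeff_add]
  exact Nat.le_add_right _ _

/-- Among all part sizes with a given sum, balanced ones maximise every coefficient. -/
lemma partPoly_coeff_le_of_balanced {ι : Type*} {s : Finset ι} {b : ι → ℕ}
    (hb : ∀ i ∈ s, ∀ j ∈ s, b i ≤ b j + 1) (r : ℕ) (a : ι → ℕ)
    (hab : ∑ i ∈ s, a i = ∑ i ∈ s, b i) :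
    (partPoly s a).coeff r ≤ (partPoly s b).coeff r := by
  induction hm : ∑ i ∈ s, (a i - b i) using Nat.strong_induction_on generalizing a with
  | _ m ih =>
    subst hm
    by_cases h : ∃ i ∈ s, b i < a i
    · obtain ⟨i, hi, hbi⟩ := h
      obtain ⟨j, hj, hbj⟩ : ∃ j ∈ s, a j < b j := by
        by_contra! hcon
        exact (sum_lt_sum hcon ⟨i, hi, hbi⟩).ne' hab
      have hij : i ≠ j := by rintro rfl; omega
      have hbal := hb j hj i hi
      let a' : ι → ℕ := fun k => if k = i then a i - 1 else if k = j then a j + 1 else a k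
      have hi' : a' i = a i - 1 := by simp [a']
      have hj' : a' j = a j + 1 := by simp [a', hij.symm]
      have ho : ∀ k, k ≠ i → k ≠ j → a' k = a k := fun k h1 h2 => by simp [a', h1, h2]
      refine (partPoly_coeff_le_of_move hi hj hij (by omega) hj' (by omega) ho r).trans
        (ih _ ?_ a' ?_ rfl)
      · refine sum_lt_sum (fun k _ => ?_) ⟨i, hi, by omega⟩
        by_cases h1 : k = i
        · subst h1; omega
        by_cases h2 : k = j
        · subst h2; omega
        rw [ho k h1 h2]
      · rw [← hab]
        have hjm : j ∈ s.erase i := mem_erase.2 ⟨hij.symm, hj⟩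
        rw [← add_sum_erase _ _ hi, ← add_sum_erase _ _ hjm, ← add_sum_erase s _ hi,
          ← add_sum_erase _ _ hjm, hi', hj']
        have : ∑ k ∈ (s.erase i).erase j, a' k = ∑ k ∈ (s.erase i).erase j, a k := by
          refine sum_congr rfl fun k hk => ?_
          simp only [mem_erase] at hk
          exact ho k hk.2.1 hk.1
        omega
    · push Not at h
      have := (sum_eq_sum_iff_of_le h).1 hab
      refine le_of_eq ?_
      unfold partPoly
      rw [prod_congr rfl fun k hk => by rw [this k hk]]

/-- The number of elements of `range n` in the residue class `i` modulo `ℓ`. -/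
def residueClassSize (n ℓ i : ℕ) : ℕ := #{x ∈ range n | x % ℓ = i}

lemma sum_residueClassSize (n : ℕ) {ℓ : ℕ} (hℓ : 0 < ℓ) :
    ∑ i ∈ range ℓ, residueClassSize n ℓ i = n := by
  have := card_eq_sum_card_fiberwise (f := (· % ℓ)) (s := range n) (t := range ℓ)
    (fun x _ => by simpa using Nat.mod_lt x hℓ)
  simpa [residueClassSize] using this.symm

lemma residueClassSize_le (n : ℕ) {ℓ : ℕ} (hℓ : 0 < ℓ) :
    ∀ i ∈ range ℓ, ∀ j ∈ range ℓ, residueClassSize n ℓ i ≤ residueClassSize n ℓ j + 1 := by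
  have key : ∀ i ∈ range ℓ, residueClassSize n ℓ i = n / ℓ + if i < n % ℓ then 1 else 0 := by
    intro i hi
    have hi := mem_range.1 hi
    have := Nat.count_modEq_card n hℓ i
    rw [Nat.mod_eq_of_lt hi, Nat.count_eq_card_filter_range] at this
    rw [← this, residueClassSize]
    simp only [Nat.ModEq, Nat.mod_eq_of_lt hi]
  intro i hi j hj
  rw [key i hi, key j hj]
  split_ifs <;> omega

namespace SimpleGraph

variable {V : Type*} (G : SimpleGraph V)

/-- The `r`-cliques of `G` contained in the finite set `S`. -/
noncomputable def cliquesIn (S : Finset V) (r : ℕ) : Finset (Finset V) :=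
  {A ∈ S.powersetCard r | G.IsClique A}

variable {G}

lemma mem_cliquesIn {S A : Finset V} {r : ℕ} :
    A ∈ G.cliquesIn S r ↔ (A ⊆ S ∧ #A = r) ∧ G.IsClique A := by
  simp [cliquesIn, mem_powersetCard]

/-- Cliques either lie in `N`, or are obtained from a vertex `w ∉ N` by adding a clique
in its neighbourhood. -/
lemma card_cliquesIn_succ_le {S N : Finset V} {r m : ℕ} (hN : N ⊆ S)
    (hm : ∀ w ∈ S, #(G.cliquesIn {x ∈ S | G.Adj w x} r) ≤ m) :
    #(G.cliquesIn S (r + 1)) ≤ #(G.cliquesIn N (r + 1)) + (#S - #N) * m := by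
  have hsub : G.cliquesIn S (r + 1) ⊆ G.cliquesIn N (r + 1) ∪
      (S \ N).biUnion fun w => (G.cliquesIn {x ∈ S | G.Adj w x} r).image (insert w) := by
    intro A hA
    obtain ⟨⟨hAS, hAr⟩, hAc⟩ := mem_cliquesIn.1 hA
    by_cases hAN : A ⊆ N
    · exact mem_union_left _ (mem_cliquesIn.2 ⟨⟨hAN, hAr⟩, hAc⟩)
    · obtain ⟨w, hwA, hwN⟩ := not_subset.1 hAN
      refine mem_union_right _ (mem_biUnion.2 ⟨w, mem_sdiff.2 ⟨hAS hwA, hwN⟩, mem_image.2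
        ⟨A.erase w, mem_cliquesIn.2 ⟨⟨fun x hx => ?_, ?_⟩, ?_⟩, insert_erase hwA⟩⟩)
      · obtain ⟨hxw, hxA⟩ := mem_erase.1 hx
        exact mem_filter.2 ⟨hAS hxA, hAc hwA hxA hxw.symm⟩
      · rw [card_erase_of_mem hwA, hAr, Nat.add_sub_cancel]
      · exact hAc.subset (by exact_mod_cast erase_subset w A)
  refine (card_le_card hsub).trans ((card_union_le _ _).trans (Nat.add_le_add_left ?_ _))
  rw [← card_sdiff_of_subset hN]
  exact card_biUnion_le_card_mul _ _ _ fun w hw =>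
    card_image_le.trans (hm w (mem_sdiff.1 hw).1)

/-- **Zykov's theorem** in terms of balanced part sizes. -/
lemma card_cliquesIn_le_partPoly_coeff (ℓ : ℕ) :
    ∀ (S : Finset V), G.cliquesIn S (ℓ + 1) = ∅ → ∀ b : ℕ → ℕ,
      (∀ i ∈ range ℓ, ∀ j ∈ range ℓ, b i ≤ b j + 1) → ∑ i ∈ range ℓ, b i = #S →
      ∀ r, #(G.cliquesIn S r) ≤ (partPoly (range ℓ) b).coeff r := by
  induction ℓ with
  | zero =>
    intro S _ b _ hS r
    have hS : S = ∅ := by simpa using hS.symm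
    subst hS
    rcases r with _ | r
    · simp [cliquesIn, partPoly, filter_singleton]
    · simp [cliquesIn, powersetCard_eq_empty.2 (show #(∅ : Finset V) < r + 1 by simp)]
  | succ ℓ ih =>
    intro S hS b hb hbS r
    rcases r with _ | r
    · refine (card_filter_le _ _).trans ?_
      simp [partPoly, Polynomial.coeff_zero_eq_eval_zero, Polynomial.eval_prod]
    rcases S.eq_empty_or_nonempty with rfl | hne
    · simp [cliquesIn, powersetCard_eq_empty.2 (show #(∅ : Finset V) < r + 1 by simp)]
    obtain ⟨v, hv, hmax⟩ := exists_max_image S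
      (fun w => #(G.cliquesIn {x ∈ S | G.Adj w x} r)) hne
    have hNS : {x ∈ S | G.Adj v x} ⊆ S := filter_subset _ _
    have hvN : ∀ x ∈ ({x ∈ S | G.Adj v x} : Finset V), G.Adj v x :=
      fun x hx => (mem_filter.1 hx).2
    have hstep := card_cliquesIn_succ_le hNS hmax
    generalize ({x ∈ S | G.Adj v x} : Finset V) = N at hNS hvN hstep
    have hN : G.cliquesIn N (ℓ + 1) = ∅ := by
      refine eq_empty_of_forall_notMem fun A hA => ?_
      obtain ⟨⟨hAN, hAr⟩, hAc⟩ := mem_cliquesIn.1 hA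
      refine notMem_empty (insert v A) (hS ▸ mem_cliquesIn.2 ⟨⟨?_, ?_⟩, ?_⟩)
      · exact insert_subset hv (hAN.trans hNS)
      · rw [card_insert_of_notMem fun h => G.irrefl (hvN v (hAN h)), hAr]
      · rw [coe_insert]
        exact hAc.insert fun x hx _ => hvN x (hAN hx)
    obtain ⟨c, hc, hcN⟩ : ∃ c : ℕ → ℕ,
        (∀ i ∈ range ℓ, ∀ j ∈ range ℓ, c i ≤ c j + 1) ∧ ∑ i ∈ range ℓ, c i = #N := by
      rcases Nat.eq_zero_or_pos ℓ with rfl | hℓ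
      · refine ⟨fun _ => 0, by simp, ?_⟩
        suffices N = ∅ by simp [this]
        refine eq_empty_of_forall_notMem fun x hx => ?_
        have hmem : {x} ∈ G.cliquesIn N (0 + 1) := mem_cliquesIn.2 (by simpa using hx)
        simp [hN] at hmem
      · exact ⟨residueClassSize #N ℓ, residueClassSize_le _ hℓ, sum_residueClassSize _ hℓ⟩
    let a : ℕ → ℕ := fun i => if i = ℓ then #S - #N else c i
    have hac : ∀ i ∈ range ℓ, a i = c i := fun i hi => if_neg (mem_range.1 hi).ne
    have haℓ : a ℓ = #S - #N := if_pos rfl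
    have ha : ∑ i ∈ range (ℓ + 1), a i = #S := by
      rw [sum_range_succ, sum_congr rfl hac, hcN, haℓ]
      exact Nat.add_sub_cancel' (card_le_card hNS)
    have hcoeff : (partPoly (range (ℓ + 1)) a).coeff (r + 1) =
        (partPoly (range ℓ) c).coeff (r + 1) + (#S - #N) * (partPoly (range ℓ) c).coeff r := by
      have hpoly : partPoly (range (ℓ + 1)) a = partPoly (range ℓ) c +
          Polynomial.C (#S - #N) * (partPoly (range ℓ) c * Polynomial.X) := by
        unfold partPoly
        rw [prod_range_succ, haℓ, prod_congr rfl fun i hi => by rw [hac i hi]]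
        ring
      rw [hpoly, Polynomial.coeff_add, Polynomial.coeff_C_mul, Polynomial.coeff_mul_X]
    calc #(G.cliquesIn S (r + 1))
        ≤ #(G.cliquesIn N (r + 1)) + (#S - #N) * #(G.cliquesIn N r) := hstep
      _ ≤ (partPoly (range (ℓ + 1)) a).coeff (r + 1) := by
        rw [hcoeff]
        gcongr
        · exact ih N hN c hc hcN _
        · exact ih N hN c hc hcN _
      _ ≤ _ := partPoly_coeff_le_of_balanced hb _ a (ha.trans hbS.symm)

end SimpleGraph

/-- There are at least as many partial transversals of size `r` of the fibres of `f` over `T`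
as the `r`-th coefficient of the polynomial of the fibre sizes. -/
lemma partPoly_coeff_le_card_transversals {V κ : Type*} [Fintype V] [DecidableEq κ]
    (f : V → κ) (T : Finset κ) :
    ∀ r, (partPoly T fun i => #{x | f x = i}).coeff r ≤
      #{A : Finset V | (∀ x ∈ A, f x ∈ T) ∧ #A = r ∧ Set.InjOn f A} := by
  induction T using Finset.induction_on with
  | empty =>
    rintro (_ | r)
    · simp only [partPoly, prod_empty, Polynomial.coeff_one_zero]
      exact card_pos.2 ⟨∅, by simp⟩
    · simp [partPoly, Polynomial.coeff_one]
  | insert i T hi ih =>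
    rintro (_ | r)
    · refine le_trans (b := 1) ?_ (card_pos.2 ⟨∅, by simp⟩)
      simp [partPoly, Polynomial.coeff_zero_eq_eval_zero, Polynomial.eval_prod]
    have hpoly : partPoly (insert i T) (fun i => #{x | f x = i}) =
        partPoly T (fun i => #{x | f x = i}) + Polynomial.C #{x | f x = i} *
          (partPoly T (fun i => #{x | f x = i}) * Polynomial.X) := by
      unfold partPoly
      rw [prod_insert hi]
      ring
    rw [hpoly, Polynomial.coeff_add, Polynomial.coeff_C_mul, Polynomial.coeff_mul_X]
    refine (Nat.add_le_add (ih (r + 1)) (Nat.mul_le_mul_left _ (ih r))).trans ?_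
    rw [← card_product]
    have himg : Set.InjOn (fun p : V × Finset V => insert p.1 p.2)
        (({x | f x = i} : Finset V) ×ˢ
          ({A : Finset V | (∀ x ∈ A, f x ∈ T) ∧ #A = r ∧ Set.InjOn f A} : Finset _) :
            Finset (V × Finset V)) := by
      rintro ⟨x, A⟩ hA ⟨y, B⟩ hB hAB
      simp only [coe_product, Set.mem_prod, mem_coe, mem_filter, mem_univ, true_and] at hA hB hAB
      have hxA : x ∉ A := fun h => hi (hA.1 ▸ hA.2.1 x h)
      have hyB : y ∉ B := fun h => hi (hB.1 ▸ hB.2.1 y h)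
      have hxB : x ∉ B := fun h => hi (hA.1 ▸ hB.2.1 x h)
      have hxy : x = y := by
        have : x ∈ insert y B := hAB ▸ mem_insert_self x A
        exact (mem_insert.1 this).resolve_right hxB
      subst hxy
      rw [← erase_insert hxA, ← erase_insert hyB, hAB]
    rw [← card_image_of_injOn himg, ← card_union_of_disjoint]
    · refine card_le_card (union_subset (fun A hA => ?_) fun A hA => ?_)
      · simp only [mem_filter, mem_univ, true_and] at hA ⊢
        exact ⟨fun x hx => mem_insert_of_mem (hA.1 x hx), hA.2⟩
      · obtain ⟨⟨x, B⟩, hB, rfl⟩ := mem_image.1 hA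
        simp only [mem_product, mem_filter, mem_univ, true_and] at hB ⊢
        obtain ⟨hx, hBT, hBr, hBinj⟩ := hB
        have hxB : x ∉ B := fun h => hi (hx ▸ hBT x h)
        refine ⟨?_, by rw [card_insert_of_notMem hxB, hBr], ?_⟩
        · intro y hy
          rcases mem_insert.1 hy with rfl | hy
          · exact mem_insert.2 (Or.inl hx)
          · exact mem_insert_of_mem (hBT y hy)
        · rw [coe_insert, Set.injOn_insert (by simpa using hxB)]
          refine ⟨hBinj, ?_⟩
          rintro ⟨y, hy, hyx⟩
          exact hi (hx ▸ hyx ▸ hBT y hy)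
    · refine disjoint_left.2 fun A hA hA' => ?_
      obtain ⟨⟨x, B⟩, hB, rfl⟩ := mem_image.1 hA'
      simp only [mem_product, mem_filter, mem_univ, true_and] at hA hB
      exact hi (hB.1 ▸ hA.1 x (mem_insert_self x B))

theorem stmt_16 (n ℓ r : ℕ) (hr : 2 ≤ r) (hrℓ : r ≤ ℓ)
    (G : SimpleGraph (Fin n)) (hfree : G.CliqueFree (ℓ + 1)) :
    (G.cliqueFinset r).card ≤ turanCount n ℓ r := by
  have hℓ : 0 < ℓ := by omega
  have hcliques : G.cliqueFinset r = G.cliquesIn univ r := by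
    ext A
    simp [SimpleGraph.mem_cliquesIn, SimpleGraph.isNClique_iff, and_comm]
  have hempty : G.cliquesIn univ (ℓ + 1) = ∅ :=
    eq_empty_of_forall_notMem fun A hA =>
      have hA := SimpleGraph.mem_cliquesIn.1 hA
      hfree A ⟨hA.2, hA.1.2⟩
  have hsize : (fun i => #{x : Fin n | x.val % ℓ = i}) = residueClassSize n ℓ := by
    funext i
    rw [residueClassSize, ← card_map Fin.valEmbedding]
    congr 1
    ext x
    simp only [mem_map, mem_filter, mem_univ, true_and, mem_range, Fin.valEmbedding_apply]
    exact ⟨fun ⟨y, hy, hyx⟩ => hyx ▸ ⟨y.isLt, hy⟩, fun ⟨hx, hxi⟩ => ⟨⟨x, hx⟩, hxi, rfl⟩⟩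
  have hle := SimpleGraph.card_cliquesIn_le_partPoly_coeff ℓ univ hempty
    (residueClassSize n ℓ) (residueClassSize_le n hℓ)
    (by rw [sum_residueClassSize n hℓ, card_univ, Fintype.card_fin]) r
  have htrans := partPoly_coeff_le_card_transversals (fun x : Fin n => x.val % ℓ) (range ℓ) r
  rw [hsize] at htrans
  rw [hcliques]
  refine (hle.trans htrans).trans (card_le_card fun A hA => ?_)
  simp only [mem_filter, mem_univ, true_and] at hA ⊢
  exact ⟨hA.2.1, fun x hx y hy hxy h => hxy (hA.2.2 hx hy h)⟩
end

section
/- Fix ℓ ≥ r ≥ 3 and δ > 0, and set ε = δ. There exists n₀ such that for all n ≥ n₀ the following holds: if G is an n-vertex K_{ℓ+1}-free simple graph containing at least (1−ε)·t_r(n,ℓ) cliques on r vertices, then the vertex set of G has a partition V₁ ∪ … ∪ V_ℓ such that the number of edges of G with both endpoints in the same part is at most δ·n². -/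
open Finset
open scoped Classical

theorem exists_partition_inner_add_le {V : Type*} (G : SimpleGraph V) (l : ℕ) :
    ∀ U : Finset V,
    (∀ A ⊆ U, ¬ G.IsNClique (l + 1) A) → ∃ f : V → ℕ, (∀ v ∈ U, f v < l) ∧
      ∑ x ∈ U, ∑ y ∈ U, (if G.Adj x y then (1 : ℝ) else 0) +
        ∑ x ∈ U, ∑ y ∈ U, (if G.Adj x y ∧ f x = f y then (1 : ℝ) else 0) ≤
      ∑ x ∈ U, ∑ y ∈ U, (if f x = f y then (0 : ℝ) else 1) := by
  induction l with
  | zero =>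
    intro U hU
    have : U = ∅ := by
      rw [eq_empty_iff_forall_notMem]
      intro v hv
      exact hU {v} (by simpa using hv) (by simp)
    subst this
    exact ⟨fun _ => 0, by simp, by simp⟩
  | succ l ih =>
    intro U hU
    rcases U.eq_empty_or_nonempty with rfl | hne
    · exact ⟨fun _ => 0, by simp, by simp⟩
    obtain ⟨x, hxU, hx⟩ := U.exists_max_image (fun x => (U.filter (G.Adj x)).card) hne
    set W := U.filter (G.Adj x) with hW
    have hWU : W ⊆ U := filter_subset _ _
    obtain ⟨f, hf, hle⟩ := ih W (fun A hA hc => hU (insert x A)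
      (insert_subset hxU (hA.trans hWU))
      (hc.insert fun b hb => (mem_filter.1 (hA hb)).2))
    refine ⟨fun v => if v ∈ W then f v else l, fun v _ => ?_, ?_⟩
    · dsimp only
      split_ifs with h
      · exact (hf v h).trans (Nat.lt_succ_self l)
      · exact Nat.lt_succ_self l
    set T := U \ W with hT
    have split : ∀ g : V → V → ℝ, (∑ x ∈ U, ∑ y ∈ U, g x y) =
        ∑ x ∈ T, ∑ y ∈ T, g x y + ∑ x ∈ T, ∑ y ∈ W, g x y +
        (∑ x ∈ W, ∑ y ∈ T, g x y + ∑ x ∈ W, ∑ y ∈ W, g x y) := by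
      intro g
      simp_rw [← sum_sdiff hWU, ← hT, sum_add_distrib]
    have hdeg : ∑ x ∈ T, ∑ y ∈ T, (if G.Adj x y then (1 : ℝ) else 0) +
        ∑ x ∈ T, ∑ y ∈ W, (if G.Adj x y then (1 : ℝ) else 0) ≤ T.card * W.card := by
      rw [← sum_add_distrib, ← nsmul_eq_mul, ← sum_const]
      refine sum_le_sum fun z hz => ?_
      rw [hT, sum_sdiff hWU, sum_boole]
      exact_mod_cast hx z (mem_sdiff.1 hz).1
    have hsymm : ∑ x ∈ W, ∑ y ∈ T, (if G.Adj x y then (1 : ℝ) else 0) =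
        ∑ x ∈ T, ∑ y ∈ W, (if G.Adj x y then (1 : ℝ) else 0) := by
      rw [sum_comm]; simp_rw [G.adj_comm]
    have hTW : ∀ v ∈ T, v ∉ W := fun v hv => (mem_sdiff.1 hv).2
    set F : V → ℕ := fun v => if v ∈ W then f v else l with hF
    have hFW : ∀ v ∈ W, F v = f v := fun v hv => by simp [hF, hv]
    have hFT : ∀ v ∈ T, F v = l := fun v hv => by simp [hF, hTW v hv]
    have hne : ∀ a ∈ T, ∀ b ∈ W, F a ≠ F b := fun a ha b hb => by
      rw [hFT a ha, hFW b hb]; exact (hf b hb).ne'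
    rw [split, split (fun x y => if G.Adj x y ∧ F x = F y then (1 : ℝ) else 0),
      split (fun x y => if F x = F y then (0 : ℝ) else 1), hsymm]
    have e1 : ∑ x ∈ T, ∑ y ∈ T, (if G.Adj x y ∧ F x = F y then (1 : ℝ) else 0) =
        ∑ x ∈ T, ∑ y ∈ T, (if G.Adj x y then (1 : ℝ) else 0) :=
      sum_congr rfl fun a ha => sum_congr rfl fun b hb => by simp [hFT a ha, hFT b hb]
    have e2 : ∑ x ∈ T, ∑ y ∈ W, (if G.Adj x y ∧ F x = F y then (1 : ℝ) else 0) = 0 :=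
      sum_eq_zero fun a ha => sum_eq_zero fun b hb => by simp [hne a ha b hb]
    have e3 : ∑ x ∈ W, ∑ y ∈ T, (if G.Adj x y ∧ F x = F y then (1 : ℝ) else 0) = 0 :=
      sum_eq_zero fun a ha => sum_eq_zero fun b hb => by simp [(hne b hb a ha).symm]
    have e4 : ∑ x ∈ W, ∑ y ∈ W, (if G.Adj x y ∧ F x = F y then (1 : ℝ) else 0) =
        ∑ x ∈ W, ∑ y ∈ W, (if G.Adj x y ∧ f x = f y then (1 : ℝ) else 0) :=
      sum_congr rfl fun a ha => sum_congr rfl fun b hb => by rw [hFW a ha, hFW b hb]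
    have e5 : ∑ x ∈ T, ∑ y ∈ T, (if F x = F y then (0 : ℝ) else 1) = 0 :=
      sum_eq_zero fun a ha => sum_eq_zero fun b hb => by simp [hFT a ha, hFT b hb]
    have e6 : ∑ x ∈ T, ∑ y ∈ W, (if F x = F y then (0 : ℝ) else 1) = T.card * W.card := by
      rw [sum_congr rfl fun a ha => sum_congr rfl fun b hb => if_neg (hne a ha b hb)]
      simp
    have e7 : ∑ x ∈ W, ∑ y ∈ T, (if F x = F y then (0 : ℝ) else 1) = T.card * W.card := by
      rw [sum_congr rfl fun a ha => sum_congr rfl fun b hb => if_neg (hne b hb a ha).symm]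
      simp [mul_comm]
    have e8 : ∑ x ∈ W, ∑ y ∈ W, (if F x = F y then (0 : ℝ) else 1) =
        ∑ x ∈ W, ∑ y ∈ W, (if f x = f y then (0 : ℝ) else 1) :=
      sum_congr rfl fun a ha => sum_congr rfl fun b hb => by rw [hFW a ha, hFW b hb]
    rw [e1, e2, e3, e4, e5, e6, e7, e8]
    linarith

section CliqueCounts

variable {V : Type*} [Fintype V] (G : SimpleGraph V)

/-- The common neighbourhood of a finite set of vertices. -/
noncomputable def commonNbrs (C : Finset V) : Finset V := univ.filter fun v => ∀ x ∈ C, G.Adj v x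

theorem sum_cliqueFinset_succ_erase (s : ℕ) (f : Finset V → ℝ) :
    ∑ A ∈ G.cliqueFinset (s + 1), ∑ v ∈ A, f (A.erase v) =
      ∑ C ∈ G.cliqueFinset s, ((commonNbrs G C).card : ℝ) * f C := by
  simp_rw [← nsmul_eq_mul, ← Finset.sum_const]
  rw [Finset.sum_sigma', Finset.sum_sigma']
  refine Finset.sum_bij' (fun p _ => ⟨p.1.erase p.2, p.2⟩) (fun p _ => ⟨insert p.2 p.1, p.2⟩)
    ?_ ?_ ?_ ?_ ?_
  · rintro ⟨A, v⟩ h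
    simp only [mem_sigma, SimpleGraph.mem_cliqueFinset_iff, SimpleGraph.isNClique_iff] at h
    obtain ⟨⟨hc, hn⟩, hv⟩ := h
    simp only [mem_sigma, SimpleGraph.mem_cliqueFinset_iff, SimpleGraph.isNClique_iff, commonNbrs,
      mem_filter, mem_univ, true_and]
    refine ⟨⟨hc.subset (by simp), by rw [card_erase_of_mem hv, hn]; rfl⟩, fun x hx => ?_⟩
    exact hc hv (mem_of_mem_erase hx) (ne_of_mem_erase hx).symm
  · rintro ⟨C, v⟩ h
    simp only [mem_sigma, SimpleGraph.mem_cliqueFinset_iff, commonNbrs,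
      mem_filter, mem_univ, true_and] at h ⊢
    exact ⟨h.1.insert h.2, by simp⟩
  · rintro ⟨A, v⟩ h
    simp only [mem_sigma] at h
    simp [insert_erase h.2]
  · rintro ⟨C, v⟩ h
    simp only [mem_sigma, commonNbrs, mem_filter] at h
    have : v ∉ C := fun hv => G.irrefl (h.2.2 v hv)
    simp [erase_insert this]
  · intros; rfl

theorem sum_card_commonNbrs (s : ℕ) :
    ∑ C ∈ G.cliqueFinset s, ((commonNbrs G C).card : ℝ) =
      (s + 1) * ((G.cliqueFinset (s + 1)).card : ℝ) := by
  have h := sum_cliqueFinset_succ_erase G s (fun _ => 1)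
  simp only [mul_one] at h
  rw [← h]
  have : ∀ A ∈ G.cliqueFinset (s + 1), ∑ v ∈ A, (1 : ℝ) = s + 1 := by
    intro A hA
    simp [((G.mem_cliqueFinset_iff).1 hA).card_eq]
  rw [sum_congr rfl this]
  rw [sum_const, nsmul_eq_mul, mul_comm]

theorem sum_card_commonNbrs_erase_le (s : ℕ) (A : Finset V) (hA : A.card = s + 1) :
    ∑ v ∈ A, ((commonNbrs G (A.erase v)).card : ℝ) ≤
      Fintype.card V + s * ((commonNbrs G A).card : ℝ) := by
  have key : ∀ w : V, ∑ v ∈ A, (if w ∈ commonNbrs G (A.erase v) then (1 : ℝ) else 0) ≤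
      1 + s * (if w ∈ commonNbrs G A then (1 : ℝ) else 0) := by
    intro w
    rw [← sum_filter, sum_const, nsmul_eq_mul, mul_one]
    split_ifs with hw
    · have := card_filter_le A (fun v => w ∈ commonNbrs G (A.erase v))
      rw [hA] at this
      have : ((A.filter (fun v => w ∈ commonNbrs G (A.erase v))).card : ℝ) ≤ (s + 1 : ℕ) := by
        exact_mod_cast this
      push_cast at this
      linarith
    · have : (A.filter (fun v => w ∈ commonNbrs G (A.erase v))).card ≤ 1 := by
        rw [card_le_one]
        intro a ha b hb
        by_contra hab
        apply hw
        simp only [commonNbrs, mem_filter, mem_univ, true_and, mem_erase] at ha hb ⊢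
        intro x hx
        by_cases hxa : x = a
        · exact hb.2 x ⟨fun h => hab (hxa ▸ h), hx⟩
        · exact ha.2 x ⟨hxa, hx⟩
      have : ((A.filter (fun v => w ∈ commonNbrs G (A.erase v))).card : ℝ) ≤ 1 := by
        exact_mod_cast this
      linarith
  have h := sum_le_sum (fun w (_ : w ∈ (univ : Finset V)) => key w)
  rw [sum_comm, sum_add_distrib, ← mul_sum] at h
  simpa using h

/-- The Moon–Moser inequality. -/
theorem moon_moser (s : ℕ) :
    ((s + 1) * ((G.cliqueFinset (s + 1)).card : ℝ)) ^ 2 ≤ (G.cliqueFinset s).card *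
      (Fintype.card V * ((G.cliqueFinset (s + 1)).card : ℝ) +
        s * ((s + 2) * ((G.cliqueFinset (s + 2)).card : ℝ))) := by
  rw [← sum_card_commonNbrs]
  refine (sq_sum_le_card_mul_sum_sq).trans ?_
  gcongr
  have h1 := sum_cliqueFinset_succ_erase G s (fun C => (commonNbrs G C).card)
  simp_rw [sq]
  rw [← h1]
  refine (sum_le_sum fun A hA => sum_card_commonNbrs_erase_le G s A
    ((G.mem_cliqueFinset_iff).1 hA).card_eq).trans ?_
  rw [sum_add_distrib, ← mul_sum, sum_card_commonNbrs]
  simp only [sum_const, nsmul_eq_mul]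
  push_cast
  apply le_of_eq
  ring

theorem card_cliqueFinset_succ_le {l : ℕ} (hG : G.CliqueFree (l + 1)) :
    ∀ d s : ℕ, s + d = l → (s + 1) * l * ((G.cliqueFinset (s + 1)).card : ℝ) ≤
      (G.cliqueFinset s).card * (l - s) * Fintype.card V := by
  intro d
  induction d with
  | zero =>
    rintro s rfl
    have : (G.cliqueFinset (s + 1)) = ∅ := (G.cliqueFinset_eq_empty_iff).2 hG
    simp [this]
  | succ d ih =>
    intro s hs
    have hi := ih (s + 1) (by omega)
    have hm := moon_moser G s
    have hl : (l : ℝ) = s + d + 1 := by rw [← hs]; push_cast; ring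
    set a : ℝ := ((G.cliqueFinset s).card : ℝ)
    set b : ℝ := ((G.cliqueFinset (s + 1)).card : ℝ)
    set c : ℝ := ((G.cliqueFinset (s + 1 + 1)).card : ℝ)
    set n : ℝ := (Fintype.card V : ℝ)
    have ha : 0 ≤ a := by positivity
    have hn : 0 ≤ n := by positivity
    have hb : 0 ≤ b := by positivity
    rcases hb.eq_or_lt with hb | hb
    · rw [← hb, hl]
      have : (s + d + 1 - s : ℝ) = d + 1 := by ring
      rw [this, mul_zero]
      positivity
    · have h1 : (l : ℝ) * ((s + 1) * b) ^ 2 ≤ l * (a * (n * b + s * ((s + 2) * c))) :=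
        mul_le_mul_of_nonneg_left hm (by positivity)
      have h2 : (a * s) * ((s + 2) * l * c) ≤ (a * s) * (b * (l - (s + 1)) * n) := by
        apply mul_le_mul_of_nonneg_left _ (by positivity)
        push_cast at hi
        linarith
      have hs' : (0 : ℝ) < (s + 1) * b := by positivity
      refine le_of_mul_le_mul_left (a := (s + 1) * b) ?_ hs'
      nlinarith [h1, h2]

theorem card_cliqueFinset_mul_le {l : ℕ} (hG : G.CliqueFree (l + 1)) (r : ℕ) (hr : 2 ≤ r)
    (hrl : r ≤ l) :
    ((G.cliqueFinset r).card : ℝ) * (l.choose 2 * (Fintype.card V / l : ℝ) ^ 2) ≤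
      (G.cliqueFinset 2).card * (l.choose r * (Fintype.card V / l : ℝ) ^ r) := by
  induction r, hr using Nat.le_induction with
  | base => exact le_rfl
  | succ r hr ih =>
    have ih := ih (by omega)
    have h := card_cliqueFinset_succ_le G hG (l - r) r (by omega)
    have hl : (0 : ℝ) < l := by exact_mod_cast (by omega : 0 < l)
    have hc : (l.choose (r + 1) : ℝ) * (r + 1) = l.choose r * (l - r) := by
      have := Nat.choose_succ_right_eq l r
      have h2 : ((l - r : ℕ) : ℝ) = l - r := by rw [Nat.cast_sub (by omega)]
      rw [← h2]; exact_mod_cast this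
    set n : ℝ := (Fintype.card V : ℝ)
    have hn : 0 ≤ n := by positivity
    have hr0 : (0 : ℝ) < r + 1 := by positivity
    have hlr : (0 : ℝ) ≤ l - r := by
      rw [sub_nonneg]; exact_mod_cast (by omega : r ≤ l)
    refine le_of_mul_le_mul_left (a := ((r : ℝ) + 1) * l) ?_ (mul_pos hr0 hl)
    calc (r + 1) * l * (((G.cliqueFinset (r + 1)).card : ℝ) * (l.choose 2 * (n / l) ^ 2))
        ≤ ((G.cliqueFinset r).card * (l - r) * n) * (l.choose 2 * (n / l) ^ 2) := by
          rw [← mul_assoc]; gcongr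
      _ = ((G.cliqueFinset r).card * (l.choose 2 * (n / l) ^ 2)) * ((l - r) * n) := by ring
      _ ≤ ((G.cliqueFinset 2).card * (l.choose r * (n / l : ℝ) ^ r)) * ((l - r) * n) := by
          gcongr
      _ = (G.cliqueFinset 2).card * (n / l) ^ r * n * (l.choose r * (l - r)) := by ring
      _ = (r + 1) * l * ((G.cliqueFinset 2).card *
            (l.choose (r + 1) * (n / l : ℝ) ^ (r + 1))) := by
          rw [← hc, pow_succ]; field_simp

theorem two_mul_card_cliqueFinset_two :
    (2 : ℝ) * (G.cliqueFinset 2).card = ∑ x, ∑ y, if G.Adj x y then 1 else 0 := by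
  have h := sum_card_commonNbrs G 1
  have h1 : G.cliqueFinset 1 = univ.map ⟨singleton, singleton_injective⟩ := by
    ext A; simp [SimpleGraph.mem_cliqueFinset_iff, SimpleGraph.isNClique_one, eq_comm]
  rw [h1, sum_map] at h
  norm_num at h
  rw [← h]
  simp [commonNbrs, SimpleGraph.adj_comm]

theorem mul_sum_ne_le {l : ℕ} (f : V → Fin l) :
    l * ∑ x, ∑ y, (if f x = f y then (0 : ℝ) else 1) ≤ (l - 1) * (Fintype.card V : ℝ) ^ 2 := by
  have h1 : ∑ x, ∑ y, (if f x = f y then (0 : ℝ) else 1) +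
      ∑ x, ∑ y, (if f x = f y then (1 : ℝ) else 0) = (Fintype.card V : ℝ) ^ 2 := by
    simp_rw [← sum_add_distrib]
    have : ∀ x y, ((if f x = f y then (0 : ℝ) else 1) + if f x = f y then (1 : ℝ) else 0) = 1 := by
      intro x y; split_ifs <;> simp
    simp [this, sq]
  have h2 : ∑ x, ∑ y, (if f x = f y then (1 : ℝ) else 0) =
      ∑ i, ((univ.filter fun v => f v = i).card : ℝ) ^ 2 := by
    have : ∀ i, ((univ.filter fun v => f v = i).card : ℝ) ^ 2 =
        ∑ x, ∑ y, (if f x = i then (1 : ℝ) else 0) * (if f y = i then 1 else 0) := by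
      intro i
      simp_rw [← mul_sum, ← sum_mul, sum_boole, sq]
    rw [Fintype.sum_congr _ _ this]
    symm
    rw [sum_comm]
    refine sum_congr rfl fun x _ => ?_
    rw [sum_comm]
    refine sum_congr rfl fun y _ => ?_
    simp [eq_comm]
  have h3 : ∑ i, ((univ.filter fun v => f v = i).card : ℝ) = Fintype.card V := by
    have := card_eq_sum_card_fiberwise (f := f) (s := univ) (t := univ) (by simp)
    rw [← card_univ, this]; push_cast; rfl
  have h4 := sq_sum_le_card_mul_sum_sq (s := (univ : Finset (Fin l)))
    (f := fun i => ((univ.filter fun v => f v = i).card : ℝ))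
  rw [h3, ← h2] at h4
  simp only [card_univ, Fintype.card_fin] at h4
  nlinarith

theorem two_mul_card_filter_edgeFinset {l : ℕ} (f : V → Fin l) :
    (2 : ℝ) * (G.edgeFinset.filter fun e => ∃ x ∈ e, ∃ y ∈ e, x ≠ y ∧ f x = f y).card =
      ∑ x, ∑ y, if G.Adj x y ∧ f x = f y then (1 : ℝ) else 0 := by
  let H : SimpleGraph V :=
    { Adj := fun x y => G.Adj x y ∧ f x = f y
      symm := ⟨fun x y h => ⟨h.1.symm, h.2.symm⟩⟩
      loopless := ⟨fun x h => G.irrefl h.1⟩ }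
  have h1 : (G.edgeFinset.filter fun e => ∃ x ∈ e, ∃ y ∈ e, x ≠ y ∧ f x = f y) =
      H.edgeFinset := by
    ext e
    induction e with | _ a b
    simp only [mem_filter, SimpleGraph.mem_edgeFinset, SimpleGraph.mem_edgeSet, H, Sym2.mem_iff]
    refine and_congr_right fun hab => ⟨?_, fun h => ⟨a, .inl rfl, b, .inr rfl, hab.ne, h⟩⟩
    rintro ⟨x, rfl | rfl, y, rfl | rfl, hxy, h⟩
    exacts [absurd rfl hxy, h, h.symm, absurd rfl hxy]
  have h2 := H.sum_degrees_eq_twice_card_edges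
  rw [h1]
  have h3 : (∑ v, (H.degree v : ℝ)) = 2 * H.edgeFinset.card := by exact_mod_cast h2
  rw [← h3]
  refine sum_congr rfl fun v _ => ?_
  rw [← SimpleGraph.card_neighborFinset_eq_degree, SimpleGraph.neighborFinset_eq_filter]
  simp [H]

/-- Füredi's stability theorem. -/
theorem exists_partition_two_mul_card_inner_le {l : ℕ} (hl : 0 < l) (hG : G.CliqueFree (l + 1)) :
    ∃ f : V → Fin l,
      2 * ((G.edgeFinset.filter fun e => ∃ x ∈ e, ∃ y ∈ e, x ≠ y ∧ f x = f y).card : ℝ) ≤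
        (l - 1) / l * (Fintype.card V : ℝ) ^ 2 - 2 * (G.cliqueFinset 2).card := by
  obtain ⟨f, hf, h⟩ := exists_partition_inner_add_le G l univ fun A _ hA => hG A hA
  obtain ⟨F, hF⟩ : ∃ F : V → Fin l, ∀ v, f v = F v :=
    ⟨fun v => ⟨f v, hf v (mem_univ v)⟩, fun _ => rfl⟩
  simp_rw [hF, Fin.val_inj] at h
  refine ⟨F, ?_⟩
  have h2 := mul_sum_ne_le F
  rw [two_mul_card_filter_edgeFinset, two_mul_card_cliqueFinset_two]
  have hl' : (0 : ℝ) < l := by exact_mod_cast hl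
  rw [mul_comm, ← le_div_iff₀ hl'] at h2
  rw [div_mul_eq_mul_div]
  linarith

end CliqueCounts

theorem choose_mul_pow_le_turanCount (n l r : ℕ) :
    l.choose r * (n / l) ^ r ≤ turanCount n l r := by
  have hlt : ∀ (i : Fin l) (j : Fin (n / l)), (i : ℕ) + l * j < n := by
    intro i j
    have h1 : l * (j + 1) ≤ l * (n / l) := Nat.mul_le_mul_left _ j.2
    have h2 := Nat.mul_div_le n l
    have := i.2
    rw [mul_add] at h1
    omega
  let e : Fin l → Fin (n / l) → Fin n := fun i j => ⟨i + l * j, hlt i j⟩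
  have hmod : ∀ i j, (e i j : ℕ) % l = i := fun i j => by
    simp [e, Nat.add_mul_mod_self_left, Nat.mod_eq_of_lt i.2]
  have he : ∀ i j i' j', e i j = e i' j' → i = i' ∧ j = j' := by
    intro i j i' j' h
    have h1 : i = i' := by
      apply Fin.ext; rw [← hmod i j, ← hmod i' j', h]
    subst h1
    have hl : 0 < l := i.pos
    refine ⟨rfl, Fin.ext ?_⟩
    have := congrArg Fin.val h
    simp only [e] at this
    exact Nat.eq_of_mul_eq_mul_left hl (by omega)
  have hcard : ((powersetCard r (univ : Finset (Fin l))).sigma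
      (fun S => S.pi fun _ => (univ : Finset (Fin (n / l))))).card = l.choose r * (n / l) ^ r := by
    rw [card_sigma, sum_congr rfl (g := fun _ => (n / l) ^ r)]
    · simp
    · intro S hS
      simp [card_pi, (mem_powersetCard.1 hS).2]
  rw [← hcard, turanCount]
  refine card_le_card_of_injOn (fun p => p.1.attach.image fun i => e i.1 (p.2 i.1 i.2)) ?_ ?_
  · rintro ⟨S, g⟩ h
    simp only [coe_sigma, Set.mem_sigma_iff, mem_coe, mem_powersetCard] at h
    simp only [coe_filter, mem_univ, true_and, Set.mem_ofPred_eq, mem_image, mem_attach,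
      Subtype.exists]
    constructor
    · rw [card_image_of_injective, card_attach, h.1.2]
      intro a b hab
      exact Subtype.ext (he _ _ _ _ hab).1
    · rintro _ ⟨i, hi, rfl⟩ _ ⟨j, hj, rfl⟩ hne
      rw [hmod, hmod]
      intro hij
      obtain rfl := Fin.ext hij
      exact hne rfl
  · rintro ⟨S, g⟩ - ⟨S', g'⟩ - h
    simp only at h
    have key : ∀ (S S' : Finset (Fin l)) (g : ∀ i ∈ S, Fin (n / l)) (g' : ∀ i ∈ S', Fin (n / l)),
        (S.attach.image fun i => e i.1 (g i.1 i.2)) =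
          (S'.attach.image fun i => e i.1 (g' i.1 i.2)) →
        ∀ i (hi : i ∈ S), ∃ hi' : i ∈ S', g i hi = g' i hi' := by
      intro S S' g g' h i hi
      have hm : e i (g i hi) ∈ S.attach.image fun i => e i.1 (g i.1 i.2) :=
        mem_image.2 ⟨⟨i, hi⟩, mem_attach _ _, rfl⟩
      rw [h] at hm
      obtain ⟨⟨j, hj⟩, -, hje⟩ := mem_image.1 hm
      obtain ⟨h1, h2⟩ := he _ _ _ _ hje
      dsimp only at h1
      subst h1
      exact ⟨hj, h2.symm⟩
    have hS : S = S' := by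
      ext i
      exact ⟨fun hi => (key S S' g g' h i hi).1, fun hi => (key S' S g' g h.symm i hi).1⟩
    subst hS
    congr
    funext i hi
    exact (key S S g g' h i hi).2

theorem choose_mul_div_pow_le_turanCount {n l r : ℕ} (hl : 0 < l) (hn : l ≤ n) :
    (1 - r * l / n : ℝ) * (l.choose r * (n / l : ℝ) ^ r) ≤ turanCount n l r := by
  have hl' : (0 : ℝ) < l := by exact_mod_cast hl
  have hn' : (0 : ℝ) < n := by exact_mod_cast hl.trans_le hn
  have hln : (l : ℝ) / n ≤ 1 := by
    rw [div_le_one hn']; exact_mod_cast hn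
  have h1 : (n / l : ℝ) * (1 - l / n) ≤ ((n / l : ℕ) : ℝ) := by
    have := Nat.lt_floor_add_one (n / l : ℝ)
    rw [Nat.floor_div_eq_div] at this
    have h : (n / l : ℝ) * (1 - l / n) = n / l - 1 := by field_simp
    linarith
  have h2 : (1 - r * l / n : ℝ) ≤ (1 - l / n) ^ r := by
    have := one_add_mul_le_pow (a := -(l / n : ℝ)) (by linarith) r
    calc (1 - r * l / n : ℝ) = 1 + r * -(l / n : ℝ) := by ring
      _ ≤ _ := this
      _ = _ := by ring
  calc (1 - r * l / n : ℝ) * (l.choose r * (n / l : ℝ) ^ r)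
      ≤ (1 - l / n) ^ r * (l.choose r * (n / l : ℝ) ^ r) := by gcongr
    _ = l.choose r * ((n / l : ℝ) * (1 - l / n)) ^ r := by rw [mul_pow]; ring
    _ ≤ l.choose r * ((n / l : ℕ) : ℝ) ^ r := by
        have : (0 : ℝ) ≤ 1 - l / n := by linarith
        gcongr
    _ ≤ turanCount n l r := by exact_mod_cast choose_mul_pow_le_turanCount n l r

theorem exists_partition_of_card_cliqueFinset_ge {V : Type*} [Fintype V] (G : SimpleGraph V)
    {ℓ r : ℕ} (hr : 2 ≤ r) (hrℓ : r ≤ ℓ) {δ : ℝ} (hδ : 0 < δ) (hnl : ℓ ≤ Fintype.card V)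
    (hnd : (r * ℓ / δ : ℝ) ≤ Fintype.card V) (hG : G.CliqueFree (ℓ + 1))
    (hk : (1 - δ) * (turanCount (Fintype.card V) ℓ r : ℝ) ≤ ((G.cliqueFinset r).card : ℝ)) :
    ∃ f : V → Fin ℓ,
      ((G.edgeFinset.filter fun e => ∃ x ∈ e, ∃ y ∈ e, x ≠ y ∧ f x = f y).card : ℝ)
        ≤ δ * (Fintype.card V : ℝ) ^ 2 := by
  set n := Fintype.card V
  have hl : 0 < ℓ := by omega
  have hl' : (0 : ℝ) < ℓ := by exact_mod_cast hl
  have hl1 : (1 : ℝ) < ℓ := by exact_mod_cast (by omega : 1 < ℓ)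
  have hn' : (0 : ℝ) < n := by exact_mod_cast hl.trans_le hnl
  obtain ⟨f, hf⟩ := exists_partition_two_mul_card_inner_le G hl hG
  refine ⟨f, ?_⟩
  set I : ℝ := ((G.edgeFinset.filter fun e => ∃ x ∈ e, ∃ y ∈ e, x ≠ y ∧ f x = f y).card : ℝ)
  set K : ℝ := ((G.cliqueFinset 2).card : ℝ)
  have hK : 0 ≤ K := by positivity
  have hn2 : (0 : ℝ) < (n : ℝ) ^ 2 := by positivity
  have hq : (ℓ - 1 : ℝ) / ℓ ≤ 1 := by rw [div_le_one hl']; linarith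
  have hq0 : 0 ≤ (ℓ - 1 : ℝ) / ℓ := div_nonneg (by linarith) hl'.le
  rcases le_or_gt 1 δ with h1 | h1
  · have := mul_le_mul_of_nonneg_right hq hn2.le
    have := mul_le_mul_of_nonneg_right h1 hn2.le
    linarith
  have ht := choose_mul_div_pow_le_turanCount (r := r) hl hnl
  have hm := card_cliqueFinset_mul_le G hG r (by omega) hrℓ
  have hc : (0 : ℝ) < ℓ.choose r * (n / ℓ : ℝ) ^ r := by
    have : 0 < ℓ.choose r := Nat.choose_pos hrℓ
    positivity
  set c : ℝ := ℓ.choose r * (n / ℓ : ℝ) ^ r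
  have hc2 : (ℓ.choose 2 * (n / ℓ : ℝ) ^ 2) = (ℓ - 1) / ℓ * n ^ 2 / 2 := by
    rw [Nat.cast_choose_two]; field_simp
  rw [hc2] at hm
  set q : ℝ := (ℓ - 1) / ℓ
  have hx : (r * ℓ / n : ℝ) ≤ δ := by
    rw [div_le_iff₀ hδ] at hnd
    rw [div_le_iff₀ hn']; linarith
  set x : ℝ := r * ℓ / n
  have hx0 : 0 ≤ x := by positivity
  have h3 : (1 - δ) * (1 - x) * (q * n ^ 2 / 2) ≤ K := by
    refine le_of_mul_le_mul_right (a := c) ?_ hc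
    calc (1 - δ) * (1 - x) * (q * n ^ 2 / 2) * c
        = (1 - δ) * ((1 - x) * c) * (q * n ^ 2 / 2) := by ring
      _ ≤ (1 - δ) * turanCount n ℓ r * (q * n ^ 2 / 2) := by
          have : 0 ≤ 1 - δ := by linarith
          gcongr
      _ ≤ (G.cliqueFinset r).card * (q * n ^ 2 / 2) := by gcongr
      _ ≤ K * c := hm
  have hy : 1 - 2 * δ ≤ (1 - δ) * (1 - x) := by
    linarith [mul_nonneg hδ.le hx0]
  have hqn : q * (n : ℝ) ^ 2 ≤ n ^ 2 := by
    simpa using mul_le_mul_of_nonneg_right hq hn2.le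
  have hqn0 : 0 ≤ q * (n : ℝ) ^ 2 := mul_nonneg hq0 hn2.le
  have h4 := mul_le_mul_of_nonneg_right hy hqn0
  have h5 := mul_le_mul_of_nonneg_left hqn hδ.le
  linarith

theorem stmt_17 (ℓ r : ℕ) (hr : 3 ≤ r) (hrℓ : r ≤ ℓ) (δ : ℝ) (hδ : 0 < δ) :
    ∃ n₀ : ℕ, ∀ n : ℕ, n₀ ≤ n → ∀ G : SimpleGraph (Fin n),
      G.CliqueFree (ℓ + 1) →
      (1 - δ) * (turanCount n ℓ r : ℝ) ≤ ((G.cliqueFinset r).card : ℝ) →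
      ∃ f : Fin n → Fin ℓ,
        ((G.edgeFinset.filter fun e => ∃ x ∈ e, ∃ y ∈ e, x ≠ y ∧ f x = f y).card : ℝ)
          ≤ δ * (n : ℝ) ^ 2 := by
  refine ⟨max ℓ ⌈r * ℓ / δ⌉₊, fun n hn G hG hk => ?_⟩
  obtain ⟨f, hf⟩ := exists_partition_of_card_cliqueFinset_ge G (by omega) hrℓ hδ
    (by simpa using (le_max_left _ _).trans hn)
    (by simpa using Nat.ceil_le.1 ((le_max_right _ _).trans hn)) hG
    (by rw [Fintype.card_fin]; convert hk)
  rw [Fintype.card_fin] at hf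
  exact ⟨f, by convert hf⟩
end

section
/- For every C > 0 there exist ε₀ > 0 and n₀ such that for every ε with 0 < ε ≤ ε₀, every n ≥ n₀, and every triangle-free simple graph G on n vertices with at least (1/4 − ε)·n² edges, there is a partition of the vertex set of G into two parts V₁ ∪ V₂ such that the number of edges of G with both endpoints in the same part is less than C·ε·n². In other words, for triangle-free graphs the minimum fraction δ of edges that must be deleted to make the graph bipartite satisfies δ/ε → 0 as ε → 0. -/
open Finset
open scoped Classical

namespace SimpleGraph

variable {V : Type*}

/-- The edges of `G` that a two-colouring `f` leaves inside a part. -/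
def within (G : SimpleGraph V) (f : V → Fin 2) : SimpleGraph V where
  Adj x y := G.Adj x y ∧ f x = f y
  symm := ⟨fun _ _ h => ⟨h.1.symm, h.2.symm⟩⟩
  loopless := ⟨fun x h => G.loopless.irrefl x h.1⟩

/-- The edges of `G` that join the two parts of a two-colouring `f`. -/
def across (G : SimpleGraph V) (f : V → Fin 2) : SimpleGraph V where
  Adj x y := G.Adj x y ∧ f x ≠ f y
  symm := ⟨fun _ _ h => ⟨h.1.symm, h.2.symm⟩⟩
  loopless := ⟨fun x h => G.loopless.irrefl x h.1⟩

theorem within_adj {G : SimpleGraph V} {f : V → Fin 2} {x y : V} :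
    (G.within f).Adj x y ↔ G.Adj x y ∧ f x = f y := Iff.rfl

theorem across_adj {G : SimpleGraph V} {f : V → Fin 2} {x y : V} :
    (G.across f).Adj x y ↔ G.Adj x y ∧ f x ≠ f y := Iff.rfl

theorem CliqueFree.not_adj_of_common {G : SimpleGraph V} (hG : G.CliqueFree 3) {a b c : V}
    (hab : G.Adj a b) (hac : G.Adj a c) : ¬ G.Adj b c := fun hbc =>
  hG _ (is3Clique_triple_iff.2 ⟨hab, hac, hbc⟩)

variable [Fintype V]

/-- The vertices in the part opposite to `v`. -/
noncomputable def opposite (f : V → Fin 2) (v : V) : Finset V := univ.filter fun u => f u ≠ f v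

/-- The vertices in the part opposite to `v` that are not adjacent to `v`. -/
noncomputable def missing (G : SimpleGraph V) (f : V → Fin 2) (v : V) : Finset V :=
  univ.filter fun u => f u ≠ f v ∧ ¬ G.Adj v u

theorem degree_within_add_degree_across (G : SimpleGraph V) (f : V → Fin 2) (v : V) :
    (G.within f).degree v + (G.across f).degree v = G.degree v := by
  simp only [← card_neighborFinset_eq_degree]
  rw [← card_union_of_disjoint]
  · congr 1
    ext u
    simp only [mem_union, mem_neighborFinset, within_adj, across_adj]
    tauto
  · rw [Finset.disjoint_left]
    intro u
    simp only [mem_neighborFinset, within_adj, across_adj]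
    tauto

theorem card_missing_add_degree_across (G : SimpleGraph V) (f : V → Fin 2) (v : V) :
    #(G.missing f v) + (G.across f).degree v = #(opposite f v) := by
  simp only [← card_neighborFinset_eq_degree]
  rw [← card_union_of_disjoint]
  · congr 1
    ext u
    simp only [mem_union, mem_neighborFinset, missing, opposite, across_adj, mem_filter, mem_univ,
      true_and, ne_comm (a := f v)]
    tauto
  · rw [Finset.disjoint_left]
    intro u
    simp only [mem_neighborFinset, missing, across_adj, mem_filter, ne_comm (a := f v)]
    tauto

theorem sum_card_opposite (f : V → Fin 2) (v : V) :
    ∑ u, #(opposite f u) = 2 * #(opposite f v) * (Fintype.card V - #(opposite f v)) := by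
  rw [← sum_add_sum_compl (opposite f v)]
  have h1 : ∀ u ∈ opposite f v, #(opposite f u) = Fintype.card V - #(opposite f v) := by
    intro u hu
    rw [← card_compl]
    congr 1
    ext w
    simp only [opposite, mem_filter, mem_univ, true_and, mem_compl] at hu ⊢
    omega
  have h2 : ∀ u ∈ (opposite f v)ᶜ, #(opposite f u) = #(opposite f v) := by
    intro u hu
    congr 1
    ext w
    simp only [opposite, mem_filter, mem_univ, true_and, mem_compl] at hu ⊢
    omega
  rw [sum_congr rfl h1, sum_congr rfl h2, sum_const, sum_const, card_compl, smul_eq_mul,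
    smul_eq_mul]
  ring

theorem card_opposite_le_card_missing_add {G : SimpleGraph V} (hG : G.CliqueFree 3)
    {f : V → Fin 2} {u v : V} (h : (G.within f).Adj u v) :
    #(opposite f u) ≤ #(G.missing f u) + #(G.missing f v) := by
  refine (card_le_card fun w hw => ?_).trans (card_union_le _ _)
  obtain ⟨huv, hf⟩ := h
  simp only [opposite, missing, mem_union, mem_filter, mem_univ, true_and] at hw ⊢
  by_cases huw : G.Adj u w
  · exact Or.inr ⟨hf ▸ hw, hG.not_adj_of_common huv huw⟩
  · exact Or.inl ⟨hw, huw⟩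

theorem degree_within_mul_degree_across_le {G : SimpleGraph V} (hG : G.CliqueFree 3)
    (f : V → Fin 2) (v : V) :
    (G.within f).degree v * (G.across f).degree v ≤ ∑ u, #(G.missing f u) := by
  calc (G.within f).degree v * (G.across f).degree v
      = ∑ u ∈ (G.within f).neighborFinset v, (G.across f).degree v := by simp
    _ ≤ ∑ u ∈ (G.within f).neighborFinset v, #(G.missing f u) := by
        refine sum_le_sum fun u hu => ?_
        rw [← card_neighborFinset_eq_degree]
        refine card_le_card fun w hw => ?_
        rw [mem_neighborFinset] at hu hw
        simp only [missing, mem_filter, mem_univ, true_and]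
        exact ⟨fun h => hw.2 (hu.2.trans h.symm), hG.not_adj_of_common hu.1 hw.1⟩
    _ ≤ ∑ u, #(G.missing f u) := sum_le_sum_of_subset (subset_univ _)

/-- In a maximum cut every vertex sends at least half of its edges across. -/
theorem degree_within_le_degree_across {G : SimpleGraph V} {f : V → Fin 2}
    (hf : ∀ g : V → Fin 2, #(G.within f).edgeFinset ≤ #(G.within g).edgeFinset) (v : V) :
    (G.within f).degree v ≤ (G.across f).degree v := by
  have h := hf (Function.update f v (1 - f v))
  have hsub : (G.within (Function.update f v (1 - f v))).edgeFinset ⊆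
      ((G.within f).edgeFinset \ (G.within f).incidenceFinset v) ∪
        (G.across f).incidenceFinset v := by
    intro e
    induction e with
    | _ x y =>
      simp only [mem_edgeFinset, mem_edgeSet, mem_union, mem_sdiff, mem_incidenceFinset,
        mk'_mem_incidenceSet_iff]
      simp only [within_adj, across_adj, Function.update_apply]
      rintro ⟨hxy, he⟩
      have hne := hxy.ne
      split_ifs at he with hx hy hy
      · exact absurd (hx.trans hy.symm) hne
      · subst hx
        refine Or.inr ⟨⟨hxy, ?_⟩, Or.inl rfl⟩
        omega
      · subst hy
        refine Or.inr ⟨⟨hxy, ?_⟩, Or.inr rfl⟩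
        omega
      · exact Or.inl ⟨⟨hxy, he⟩, fun h => h.2.elim (fun h => hx h.symm) (fun h => hy h.symm)⟩
  have h2 := (card_le_card hsub).trans (card_union_le _ _)
  have h3 : (G.within f).incidenceFinset v ⊆ (G.within f).edgeFinset :=
    incidenceFinset_subset _ _
  have h4 := card_le_card h3
  rw [card_sdiff_of_subset h3] at h2
  simp only [card_incidenceFinset_eq_degree] at h2 h4
  omega

theorem exists_card_within_add_sum_degree_le {G : SimpleGraph V} (hG : G.CliqueFree 3) (v : V) :
    ∃ f : V → Fin 2, #(G.within f).edgeFinset + ∑ u ∈ G.neighborFinset v, G.degree u ≤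
      #G.edgeFinset := by
  refine ⟨fun u => if G.Adj v u then 1 else 0, ?_⟩
  set f : V → Fin 2 := fun u => if G.Adj v u then 1 else 0 with hf
  simp only [← card_incidenceFinset_eq_degree]
  rw [← card_biUnion, ← card_union_of_disjoint]
  · refine card_le_card (union_subset ?_ (biUnion_subset.2 fun u _ => incidenceFinset_subset _ _))
    exact edgeFinset_subset_edgeFinset.2 fun x y h => h.1
  · rw [Finset.disjoint_left]
    intro e
    induction e with
    | _ x y =>
      simp only [mem_edgeFinset, mem_edgeSet, mem_biUnion, mem_incidenceFinset,
        mk'_mem_incidenceSet_iff, mem_neighborFinset, not_exists, not_and]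
      rintro ⟨hxy, he⟩ u hu - hux
      have key : G.Adj v x ↔ G.Adj v y := by
        simp only [hf] at he
        split_ifs at he <;> simp_all
      rcases hux with rfl | rfl
      · exact hG.not_adj_of_common hu (key.1 hu) hxy
      · exact hG.not_adj_of_common (key.2 hu) hu hxy
  · intro a ha b hb hab
    rw [Function.onFun, Finset.disjoint_left]
    intro e hea heb
    rw [mem_coe, mem_neighborFinset] at ha hb
    rw [mem_incidenceFinset] at hea heb
    exact hG.not_adj_of_common ha hb (G.adj_of_mem_incidenceSet hab hea heb)

/-- The cut with fewest edges inside its parts, for triangle-free graphs. -/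
theorem card_sq_mul_card_within_le {G : SimpleGraph V} (hG : G.CliqueFree 3) {f : V → Fin 2}
    (hf : ∀ g : V → Fin 2, #(G.within f).edgeFinset ≤ #(G.within g).edgeFinset) :
    Fintype.card V ^ 2 * #(G.within f).edgeFinset + 4 * #G.edgeFinset ^ 2 ≤
      Fintype.card V ^ 2 * #G.edgeFinset := by
  have h1 : ∀ v, #(G.within f).edgeFinset + ∑ u ∈ G.neighborFinset v, G.degree u ≤
      #G.edgeFinset := fun v => by
    obtain ⟨g, hg⟩ := exists_card_within_add_sum_degree_le hG v
    have := hf g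
    omega
  have h2 : ∑ v, ∑ u ∈ G.neighborFinset v, G.degree u = ∑ u, G.degree u ^ 2 := by
    rw [sum_comm' (t' := univ) (s' := fun u => G.neighborFinset u)]
    · simp [sq]
    · simp [G.adj_comm]
  have h3 := sum_le_sum fun v (_ : v ∈ univ) => h1 v
  rw [sum_add_distrib, h2] at h3
  simp only [sum_const, card_univ, smul_eq_mul] at h3
  have h4 := sq_sum_le_card_mul_sum_sq (s := univ) (f := fun v => G.degree v)
  rw [G.sum_degrees_eq_twice_card_edges, card_univ] at h4
  nlinarith [Nat.mul_le_mul_left (Fintype.card V) h3]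

/-- Every edge inside a part has an endpoint missing many vertices of the opposite part. -/
theorem card_within_le {G : SimpleGraph V} (hG : G.CliqueFree 3) (f : V → Fin 2) {s : ℝ}
    (hs : ∀ v, 2 * s ≤ #(opposite f v)) :
    (#(G.within f).edgeFinset : ℝ) ≤
      ∑ v with s ≤ #(G.missing f v), ((G.within f).degree v : ℝ) := by
  have h : #(G.within f).edgeFinset ≤
      ∑ v with s ≤ (#(G.missing f v) : ℝ), (G.within f).degree v := by
    simp only [← card_incidenceFinset_eq_degree]
    refine (card_le_card fun e => ?_).trans card_biUnion_le
    induction e with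
    | _ x y =>
      intro hxy
      rw [mem_edgeFinset, mem_edgeSet] at hxy
      have h1 : (#(opposite f x) : ℝ) ≤ #(G.missing f x) + #(G.missing f y) :=
        mod_cast card_opposite_le_card_missing_add hG hxy
      have h2 := hs x
      simp only [mem_biUnion, mem_filter, mem_univ, true_and, mem_incidenceFinset,
        mk'_mem_incidenceSet_iff]
      by_cases hx : s ≤ #(G.missing f x)
      · exact ⟨x, hx, hxy, Or.inl rfl⟩
      · exact ⟨y, by linarith, hxy, Or.inr rfl⟩
  exact_mod_cast h

theorem card_within_lt {G : SimpleGraph V} (hG : G.CliqueFree 3) {f : V → Fin 2}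
    (hf : ∀ g : V → Fin 2, #(G.within f).edgeFinset ≤ #(G.within g).edgeFinset)
    {C ε : ℝ} (hC : 0 < C) (hε : 0 < ε) (hε1 : ε ≤ 1 / 60) (hε2 : ε ≤ (C / 120) ^ 2 / 6)
    (hV : 0 < Fintype.card V)
    (hm : (1 / 4 - ε) * (Fintype.card V : ℝ) ^ 2 ≤ #G.edgeFinset) :
    (#(G.within f).edgeFinset : ℝ) < C * ε * (Fintype.card V : ℝ) ^ 2 := by
  set n : ℝ := (Fintype.card V : ℝ) with hn
  set m : ℝ := (#G.edgeFinset : ℝ) with hm'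
  set t : ℝ := (#(G.within f).edgeFinset : ℝ) with ht
  have hn0 : 0 < n := by rw [hn]; exact_mod_cast hV
  have hm0 : 0 ≤ m := Nat.cast_nonneg _
  have hm2 : m ≤ n ^ 2 / 2 := by
    have h1 := G.card_edgeFinset_le_card_choose_two
    have h2 : (m : ℝ) ≤ ((Fintype.card V).choose 2 : ℕ) := by rw [hm']; exact_mod_cast h1
    rw [Nat.cast_choose_two] at h2
    nlinarith
  have ht2 : t ≤ 2 * ε * n ^ 2 := by
    have h : n ^ 2 * t + 4 * m ^ 2 ≤ n ^ 2 * m := by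
      rw [hn, ht, hm']
      exact_mod_cast card_sq_mul_card_within_le hG hf
    have h1 : n ^ 2 * t ≤ n ^ 2 * (4 * ε * m) := by nlinarith
    have h2 := le_of_mul_le_mul_left h1 (by positivity)
    nlinarith
  have hwithin : ∑ v, ((G.within f).degree v : ℝ) = 2 * t := by
    rw [ht]
    exact_mod_cast (G.within f).sum_degrees_eq_twice_card_edges
  have hdeg : ∑ v, (G.degree v : ℝ) = 2 * m := by
    rw [hm']
    exact_mod_cast G.sum_degrees_eq_twice_card_edges
  have hsplit : ∑ v, ((G.within f).degree v : ℝ) + ∑ v, ((G.across f).degree v : ℝ) =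
      ∑ v, (G.degree v : ℝ) := by
    rw [← sum_add_distrib]
    exact sum_congr rfl fun v _ => mod_cast degree_within_add_degree_across G f v
  have hmis : ∑ v, (#(G.missing f v) : ℝ) + ∑ v, ((G.across f).degree v : ℝ) =
      ∑ v, (#(opposite f v) : ℝ) := by
    rw [← sum_add_distrib]
    exact sum_congr rfl fun v _ => mod_cast card_missing_add_degree_across G f v
  have hopp : ∀ v, ∑ u, (#(opposite f u) : ℝ) =
      2 * #(opposite f v) * (n - #(opposite f v)) := fun v => by
    rw [hn, ← Nat.cast_sub (card_le_univ _)]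
    exact_mod_cast sum_card_opposite f v
  set S : ℝ := ∑ v, (#(G.missing f v) : ℝ) with hS
  have hS0 : 0 ≤ S := sum_nonneg fun _ _ => Nat.cast_nonneg _
  obtain ⟨v₀⟩ : Nonempty V := Fintype.card_pos_iff.1 hV
  have hS6 : S ≤ 6 * ε * n ^ 2 := by
    nlinarith [hopp v₀, sq_nonneg (n - 2 * #(opposite f v₀))]
  have hlarge : ∀ v, 2 * (n / 10) ≤ #(opposite f v) := fun v => by
    have h1 := hopp v
    have h2 : n * (n / 5) ≤ n * #(opposite f v) := by
      nlinarith [sq_nonneg (#(opposite f v) : ℝ)]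
    have h3 := le_of_mul_le_mul_left h2 hn0
    linarith
  have hsmall : ∀ v, ((G.within f).degree v : ℝ) ≤ C / 120 * n := fun v => by
    have h1 : ((G.within f).degree v : ℝ) * (G.across f).degree v ≤ S := by
      rw [hS]
      exact_mod_cast degree_within_mul_degree_across_le hG f v
    have h2 : ((G.within f).degree v : ℝ) ≤ (G.across f).degree v :=
      mod_cast degree_within_le_degree_across hf v
    refine abs_le_of_sq_le_sq' ?_ (by positivity) |>.2
    nlinarith [mul_le_mul_of_nonneg_left h2 (Nat.cast_nonneg (α := ℝ) ((G.within f).degree v)),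
      mul_le_mul_of_nonneg_right hε2 (sq_nonneg n)]
  have hpoor : (#{v | n / 10 ≤ (#(G.missing f v) : ℝ)} : ℝ) * (n / 10) ≤ S := by
    rw [← nsmul_eq_mul]
    refine (card_nsmul_le_sum _ (fun v => (#(G.missing f v) : ℝ)) _
      fun v hv => (mem_filter.1 hv).2).trans ?_
    exact sum_le_sum_of_subset_of_nonneg (subset_univ _) fun _ _ _ => Nat.cast_nonneg _
  have hfin : t ≤ #{v | n / 10 ≤ (#(G.missing f v) : ℝ)} * (C / 120 * n) := by
    refine (card_within_le hG f hlarge).trans ?_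
    rw [← nsmul_eq_mul]
    exact sum_le_card_nsmul _ _ _ fun v _ => hsmall v
  have hpos : 0 < C * ε * n ^ 2 := by positivity
  nlinarith [mul_le_mul_of_nonneg_left (hpoor.trans hS6) hC.le]

end SimpleGraph

theorem stmt_19 (C : ℝ) (hC : 0 < C) :
    ∃ ε₀ : ℝ, 0 < ε₀ ∧ ∃ n₀ : ℕ,
      ∀ ε : ℝ, 0 < ε → ε ≤ ε₀ → ∀ n : ℕ, n₀ ≤ n →
        ∀ G : SimpleGraph (Fin n), G.CliqueFree 3 →
          (1 / 4 - ε) * (n : ℝ) ^ 2 ≤ (G.edgeFinset.card : ℝ) →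
          ∃ f : Fin n → Fin 2,
            ((G.edgeFinset.filter fun e => ∃ x ∈ e, ∃ y ∈ e, x ≠ y ∧ f x = f y).card : ℝ)
              < C * ε * (n : ℝ) ^ 2 := by
  refine ⟨min (1 / 60) ((C / 120) ^ 2 / 6), by positivity, 1, fun ε hε hε₀ n hn G hG hm => ?_⟩
  obtain ⟨f, hf⟩ := Finite.exists_min fun f : Fin n → Fin 2 => #(G.within f).edgeFinset
  have h := SimpleGraph.card_within_lt hG (fun g => by convert hf g) hC hε
    (hε₀.trans (min_le_left _ _)) (hε₀.trans (min_le_right _ _))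
    (by rwa [Fintype.card_fin]) (by rw [Fintype.card_fin]; convert hm)
  rw [Fintype.card_fin] at h
  refine ⟨f, lt_of_le_of_lt (Nat.cast_le.2 (card_le_card fun e => ?_)) h⟩
  induction e with
  | _ x y =>
    simp only [mem_filter, SimpleGraph.mem_edgeFinset, SimpleGraph.mem_edgeSet, Sym2.mem_iff]
    rintro ⟨hxy, a, ha, b, hb, hab, he⟩
    refine ⟨hxy, ?_⟩
    rcases ha with rfl | rfl <;> rcases hb with rfl | rfl
    · exact absurd rfl hab
    · exact he
    · exact he.symm
    · exact absurd rfl hab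
end
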